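/- arXiv:math-ph/0511055 — 2 statements merged into one kernel-verified Lean document; each statement's English description precedes it below -/
import Mathlib

section
/- Let V be a vertex algebra and define the λ-bracket [a_λ b] = Σ_{n≥0} (λⁿ/n!) a_(n)b. Then the ℂ[T]-module V (with Ta = a_(−2)|0⟩) equipped with this λ-bracket is a Lie conformal superalgebra; explicitly, for all a,b,c ∈ V and m,n ∈ ℤ≥0 one has: (sesquilinearity) (Ta)_(n)b = −n a_(n−1)b and T(a_(n)b) = (Ta)_(n)b + a_(n)(Tb); (skewsymmetry) b_(n)a = p(a,b) Σ_{j≥0} (−1)^{n+j+1} T^{j}(a_(n+j)b)/j!; (Jacobi identity) a_(m)(b_(n)c) − p(a,b) b_(n)(a_(m)c) = Σ_{i≥0} C(m,i) (a_(i)b)_(m+n−i)c. -/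
noncomputable section

/-- Generalized binomial coefficient `C(x, k)` for `x : ℂ`, `k : ℕ`. -/
def cbinom (x : ℂ) (k : ℕ) : ℂ :=
  (∏ i ∈ Finset.range k, (x - (i : ℂ))) / (Nat.factorial k : ℂ)

/-- `C(n, k)` for an integer upper entry. -/
def zbinom (n : ℤ) (k : ℕ) : ℂ := cbinom (n : ℂ) k

/-- The Koszul sign `p(a,b) = (-1)^{p(a)p(b)}`. -/
def psgn (p q : ZMod 2) : ℂ := (-1 : ℂ) ^ (p.val * q.val)

/-- A vertex (super)algebra in Borcherds' formulation: a vector superspace `V`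
(the parity is encoded by the involution `par`), an even vacuum vector `vac` and
bilinear `n`-th products `prod n` for `n ∈ ℤ`, such that for fixed `a, b` one has
`prod n a b = 0` for `n ≫ 0`, satisfying the vacuum axioms and the Borcherds
identity. -/
structure VertexAlg (V : Type*) [AddCommGroup V] [Module ℂ V] where
  par : Module.End ℂ V
  par_invol : par * par = 1
  vac : V
  vac_even : par vac = vac
  prod : ℤ → V →ₗ[ℂ] V →ₗ[ℂ] V
  prod_par : ∀ (n : ℤ) (a b : V), prod n (par a) (par b) = par (prod n a b)
  trunc : ∀ a b : V, ∃ N : ℕ, ∀ n : ℤ, (N : ℤ) ≤ n → prod n a b = 0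
  vac_prod : ∀ (n : ℤ) (a : V), prod n vac a = if n = -1 then a else 0
  prod_vac : ∀ (n : ℤ) (a : V), -1 ≤ n → prod n a vac = if n = -1 then a else 0
  borcherds : ∀ (pa pb : ZMod 2) (a b c : V),
    par a = ((-1 : ℂ) ^ pa.val) • a → par b = ((-1 : ℂ) ^ pb.val) • b →
    ∀ m n k : ℤ,
      (∑ᶠ j : ℕ, ((-1 : ℂ) ^ j * zbinom n j) •
        (prod (m + n - (j : ℤ)) a (prod (k + (j : ℤ)) b c)
          - (psgn pa pb * (-1 : ℂ) ^ n) •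
              prod (n + k - (j : ℤ)) b (prod (m + (j : ℤ)) a c)))
      = ∑ᶠ j : ℕ, zbinom m j • prod (m + k - (j : ℤ)) (prod (n + (j : ℤ)) a b) c

namespace VertexAlg

variable {V : Type*} [AddCommGroup V] [Module ℂ V]

/-- `a` is homogeneous of parity `p`. -/
def Homog (𝒱 : VertexAlg V) (p : ZMod 2) (a : V) : Prop :=
  𝒱.par a = ((-1 : ℂ) ^ p.val) • a

/-- The infinitesimal translation operator `T a = a_(-2)|0⟩`. -/
def T (𝒱 : VertexAlg V) : Module.End ℂ V := (𝒱.prod (-2)).flip 𝒱.vac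

end VertexAlg

/-- `binomOp H j` is the operator `C(H, j) = H(H-1)⋯(H-j+1)/j!`; on an eigenvector of
`H` with eigenvalue `Δ` it acts as the scalar `C(Δ, j)`. -/
def binomOp {V : Type*} [AddCommGroup V] [Module ℂ V] (H : Module.End ℂ V) :
    ℕ → Module.End ℂ V
  | 0 => 1
  | (j+1) => (((j : ℂ) + 1)⁻¹) • ((H - (j : ℂ) • 1) * binomOp H j)

/-- `H` is a Hamiltonian operator for the vertex algebra `𝒱`: it is diagonalizable
and the eigenvalues satisfy `Δ(a_(n)b) = Δ(a) + Δ(b) - n - 1`, `Δ(|0⟩) = 0`. -/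
structure IsHamiltonian {V : Type*} [AddCommGroup V] [Module ℂ V]
    (𝒱 : VertexAlg V) (H : Module.End ℂ V) : Prop where
  diag : (⨆ μ : ℂ, LinearMap.ker (H - μ • (1 : Module.End ℂ V))) = ⊤
  vacH : H 𝒱.vac = 0
  grading : ∀ (n : ℤ) (Δa Δb : ℂ) (a b : V), H a = Δa • a → H b = Δb • b →
    H (𝒱.prod n a b) = (Δa + Δb - (n : ℂ) - 1) • 𝒱.prod n a b

theorem zbinom_zero_right (x : ℤ) : zbinom x 0 = 1 := by
  simp [zbinom, cbinom]

theorem zbinom_one_right (x : ℤ) : zbinom x 1 = x := by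
  simp [zbinom, cbinom]

theorem zbinom_succ (x : ℤ) (j : ℕ) :
    zbinom x (j + 1) = zbinom x j * ((x : ℂ) - j) / (j + 1) := by
  have h : (Nat.factorial j : ℂ) ≠ 0 := by exact_mod_cast Nat.factorial_ne_zero j
  have h' : (j : ℂ) + 1 ≠ 0 := by exact_mod_cast Nat.succ_ne_zero j
  simp only [zbinom, cbinom, Finset.prod_range_succ, Nat.factorial_succ]
  push_cast
  field_simp

theorem zbinom_zero_left {j : ℕ} (hj : j ≠ 0) : zbinom 0 j = 0 := by
  obtain ⟨k, rfl⟩ := Nat.exists_eq_succ_of_ne_zero hj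
  simp [zbinom, cbinom, Finset.prod_range_succ']

theorem zbinom_neg_one (j : ℕ) : zbinom (-1) j = (-1) ^ j := by
  induction j with
  | zero => simp [zbinom_zero_right]
  | succ j ih =>
    have h' : (j : ℂ) + 1 ≠ 0 := by exact_mod_cast Nat.succ_ne_zero j
    rw [zbinom_succ, ih]
    push_cast
    field_simp
    ring

theorem zbinom_neg_two (j : ℕ) : zbinom (-2) j = (-1) ^ j * (j + 1) := by
  induction j with
  | zero => simp [zbinom_zero_right]
  | succ j ih =>
    have h' : (j : ℂ) + 1 ≠ 0 := by exact_mod_cast Nat.succ_ne_zero j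
    rw [zbinom_succ, ih]
    push_cast
    field_simp
    ring

theorem psgn_mul_self (p q : ZMod 2) : psgn p q * psgn p q = 1 := by
  rw [psgn, ← mul_pow]
  simp

namespace VertexAlg

variable {V : Type*} [AddCommGroup V] [Module ℂ V] (𝒱 : VertexAlg V)

theorem T_apply (a : V) : 𝒱.T a = 𝒱.prod (-2) a 𝒱.vac := rfl

theorem homog_vac : 𝒱.Homog 0 𝒱.vac := by
  simp [Homog, 𝒱.vac_even]

theorem exists_homog_add (a : V) : ∃ x y : V, 𝒱.Homog 0 x ∧ 𝒱.Homog 1 y ∧ a = x + y := by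
  have h : 𝒱.par (𝒱.par a) = a := by
    rw [← Module.End.mul_apply, 𝒱.par_invol, Module.End.one_apply]
  refine ⟨(2⁻¹ : ℂ) • (a + 𝒱.par a), (2⁻¹ : ℂ) • (a - 𝒱.par a), ?_, ?_, ?_⟩
  · simp [Homog, h, add_comm]
  · have h1 : (1 : ZMod 2).val = 1 := rfl
    simp only [Homog, h1, map_smul, map_sub, h]
    module
  · module

theorem eq_of_homog {f g : V →ₗ[ℂ] V} (h : ∀ p a, 𝒱.Homog p a → f a = g a) (a : V) :
    f a = g a := by
  obtain ⟨x, y, hx, hy, rfl⟩ := 𝒱.exists_homog_add a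
  rw [map_add, map_add, h _ _ hx, h _ _ hy]

theorem jacobi {pa pb : ZMod 2} {a b : V} (ha : 𝒱.Homog pa a) (hb : 𝒱.Homog pb b)
    (c : V) (m n : ℤ) :
    𝒱.prod m a (𝒱.prod n b c) - psgn pa pb • 𝒱.prod n b (𝒱.prod m a c)
      = ∑ᶠ i : ℕ, zbinom m i • 𝒱.prod (m + n - (i : ℤ)) (𝒱.prod (i : ℤ) a b) c := by
  have h := 𝒱.borcherds pa pb a b c ha hb m 0 n
  rw [finsum_eq_single _ 0 (fun j hj => by simp [zbinom_zero_left hj])] at h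
  simpa [zbinom_zero_right] using h

/-- The Borcherds identity at `m = 0`. -/
theorem prod_prod {pa pb : ZMod 2} {a b : V} (ha : 𝒱.Homog pa a) (hb : 𝒱.Homog pb b)
    (c : V) (n k : ℤ) :
    𝒱.prod k (𝒱.prod n a b) c = ∑ᶠ j : ℕ, ((-1 : ℂ) ^ j * zbinom n j) •
        (𝒱.prod (n - (j : ℤ)) a (𝒱.prod (k + (j : ℤ)) b c)
          - (psgn pa pb * (-1 : ℂ) ^ n) •
              𝒱.prod (n + k - (j : ℤ)) b (𝒱.prod (j : ℤ) a c)) := by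
  have h := 𝒱.borcherds pa pb a b c ha hb 0 n k
  rw [finsum_eq_single (fun j : ℕ => zbinom 0 j • _) 0
    (fun j hj => by simp [zbinom_zero_left hj])] at h
  simpa [zbinom_zero_right] using h.symm

theorem prod_T_left (a b : V) (n : ℕ) :
    𝒱.prod (n : ℤ) (𝒱.T a) b = (-(n : ℂ)) • 𝒱.prod ((n : ℤ) - 1) a b := by
  refine 𝒱.eq_of_homog (f := (𝒱.prod (n : ℤ)).flip b ∘ₗ 𝒱.T)
    (g := (-(n : ℂ)) • (𝒱.prod ((n : ℤ) - 1)).flip b) (fun p a ha => ?_) a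
  simp only [LinearMap.comp_apply, LinearMap.flip_apply, LinearMap.smul_apply, T_apply]
  rw [𝒱.prod_prod ha 𝒱.homog_vac]
  cases n with
  | zero =>
    rw [finsum_eq_zero_of_forall_eq_zero]
    · simp
    · intro j
      rw [𝒱.vac_prod, 𝒱.vac_prod, if_neg (by omega), if_neg (by omega)]
      simp
  | succ n =>
    rw [finsum_eq_single _ n]
    · rw [𝒱.vac_prod, 𝒱.vac_prod, if_neg (by omega), if_pos (by push_cast; ring), zbinom_neg_two]
      have h : ((-1 : ℂ) ^ n * (-1) ^ n) = 1 := by rw [← mul_pow]; simp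
      have h2 : (-1 : ℂ) ^ (-2 : ℤ) = 1 := by norm_num
      simp only [psgn, ZMod.val_zero, mul_zero, pow_zero, h2, map_zero, ← mul_assoc, h]
      push_cast
      simp
      module
    · intro j hj
      rw [𝒱.vac_prod, 𝒱.vac_prod, if_neg (by omega), if_neg (by omega)]
      simp

theorem T_prod (a b : V) (n : ℤ) :
    𝒱.T (𝒱.prod n a b) = 𝒱.prod n a (𝒱.T b) - (n : ℂ) • 𝒱.prod (n - 1) a b := by
  refine 𝒱.eq_of_homog (f := 𝒱.T ∘ₗ (𝒱.prod n).flip b)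
    (g := (𝒱.prod n).flip (𝒱.T b) - (n : ℂ) • (𝒱.prod (n - 1)).flip b) (fun p a ha => ?_) a
  refine 𝒱.eq_of_homog (f := 𝒱.T ∘ₗ 𝒱.prod n a)
    (g := 𝒱.prod n a ∘ₗ 𝒱.T - (n : ℂ) • 𝒱.prod (n - 1) a) (fun q b hb => ?_) b
  simp only [LinearMap.comp_apply, LinearMap.sub_apply, LinearMap.smul_apply, T_apply]
  rw [𝒱.prod_prod ha hb, finsum_eq_sum_of_support_subset (s := Finset.range 2)]
  · simp [Finset.sum_range_succ, zbinom_zero_right, zbinom_one_right, 𝒱.prod_vac, sub_eq_add_neg]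
  · intro j hj
    contrapose! hj
    simp only [Finset.coe_range, Set.mem_Iio, not_lt] at hj
    rw [Function.notMem_support, 𝒱.prod_vac _ b (by omega), 𝒱.prod_vac _ a (by omega),
      if_neg (by omega), if_neg (by omega)]
    simp

theorem T_vac : 𝒱.T 𝒱.vac = 0 := by
  rw [T_apply, 𝒱.vac_prod, if_neg (by norm_num)]

theorem T_pow_apply (a : V) (j : ℕ) :
    (𝒱.T ^ j) a = (Nat.factorial j : ℂ) • 𝒱.prod (-1 - (j : ℤ)) a 𝒱.vac := by
  induction j with
  | zero => simp [𝒱.prod_vac]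
  | succ j ih =>
    rw [pow_succ', Module.End.mul_apply, ih, map_smul, T_prod, T_vac, Nat.factorial_succ,
      show (-1 - (j : ℤ) - 1) = -1 - ((j + 1 : ℕ) : ℤ) by push_cast; ring]
    push_cast
    rw [map_zero]
    module

theorem skew_symmetry {pa pb : ZMod 2} {a b : V} (ha : 𝒱.Homog pa a) (hb : 𝒱.Homog pb b)
    (n : ℕ) :
    𝒱.prod (n : ℤ) b a = psgn pa pb • ∑ᶠ j : ℕ,
      ((-1 : ℂ) ^ (n + j + 1) * ((Nat.factorial j : ℂ))⁻¹) •
        ((𝒱.T ^ j) (𝒱.prod ((n : ℤ) + (j : ℤ)) a b)) := by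
  have h := 𝒱.borcherds pa pb a b 𝒱.vac ha hb (-1) n 0
  rw [finsum_eq_single (fun j : ℕ => ((-1 : ℂ) ^ j * zbinom n j) • _) 0] at h
  · have key : ∀ j : ℕ, ((-1 : ℂ) ^ (n + j + 1) * ((Nat.factorial j : ℂ))⁻¹) •
        ((𝒱.T ^ j) (𝒱.prod ((n : ℤ) + (j : ℤ)) a b)) = (-(-1 : ℂ) ^ n) • (zbinom (-1) j •
          𝒱.prod (-1 + 0 - (j : ℤ)) (𝒱.prod ((n : ℤ) + (j : ℤ)) a b) 𝒱.vac) := by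
      intro j
      have hj : (Nat.factorial j : ℂ) ≠ 0 := by exact_mod_cast Nat.factorial_ne_zero j
      rw [T_pow_apply, zbinom_neg_one, smul_smul, smul_smul, add_zero, mul_assoc,
        inv_mul_cancel₀ hj]
      congr 1
      ring
    rw [finsum_congr key, ← smul_finsum, ← h, 𝒱.prod_vac _ b (by simp),
      𝒱.prod_vac _ a (by simp), if_neg (by simp), if_pos (by simp), zbinom_zero_right]
    have h1 : (-1 : ℂ) ^ n * (-1) ^ n = 1 := by rw [← mul_pow]; simp
    have h2 := psgn_mul_self pa pb
    simp only [map_zero, zero_sub, smul_smul, ← neg_smul, zpow_natCast]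
    rw [show (psgn pa pb * (-(-1 : ℂ) ^ n * ((-1) ^ 0 * 1 * -(psgn pa pb * (-1) ^ n))))
      = (psgn pa pb * psgn pa pb) * ((-1 : ℂ) ^ n * (-1) ^ n) by ring, h1, h2]
    simp
  · intro j hj
    rw [𝒱.prod_vac _ b (by omega), 𝒱.prod_vac _ a (by omega), if_neg (by omega),
      if_neg (by omega)]
    simp

end VertexAlg

/-- Let `V` be a vertex algebra and define the λ-bracket `[a_λ b] = Σ_{n≥0} (λⁿ/n!) a_(n)b`.
Then the `ℂ[T]`-module `V` (with `Ta = a_(-2)|0⟩`) equipped with this λ-bracket is a Lie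
conformal superalgebra; explicitly, for all `a, b, c ∈ V` and `m, n ∈ ℤ≥0`:
sesquilinearity, skewsymmetry and the Jacobi identity hold as stated below. -/
theorem statement_2 {V : Type*} [AddCommGroup V] [Module ℂ V] (𝒱 : VertexAlg V) :
    -- (sesquilinearity) (Ta)_(n)b = -n a_(n-1)b
    (∀ (a b : V) (n : ℕ),
        𝒱.prod (n : ℤ) (𝒱.T a) b = (-(n : ℂ)) • 𝒱.prod ((n : ℤ) - 1) a b) ∧
    -- (sesquilinearity) T(a_(n)b) = (Ta)_(n)b + a_(n)(Tb)
    (∀ (a b : V) (n : ℕ),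
        𝒱.T (𝒱.prod (n : ℤ) a b)
          = 𝒱.prod (n : ℤ) (𝒱.T a) b + 𝒱.prod (n : ℤ) a (𝒱.T b)) ∧
    -- (skewsymmetry) b_(n)a = p(a,b) Σ_{j≥0} (-1)^{n+j+1} T^j (a_(n+j)b) / j!
    (∀ (pa pb : ZMod 2) (a b : V), 𝒱.Homog pa a → 𝒱.Homog pb b → ∀ n : ℕ,
        𝒱.prod (n : ℤ) b a
          = psgn pa pb • ∑ᶠ j : ℕ,
              ((-1 : ℂ) ^ (n + j + 1) * ((Nat.factorial j : ℂ))⁻¹) •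
                ((𝒱.T ^ j) (𝒱.prod ((n : ℤ) + (j : ℤ)) a b))) ∧
    -- (Jacobi identity) a_(m)(b_(n)c) - p(a,b) b_(n)(a_(m)c)
    --                     = Σ_{i≥0} C(m,i) (a_(i)b)_(m+n-i)c
    (∀ (pa pb : ZMod 2) (a b c : V), 𝒱.Homog pa a → 𝒱.Homog pb b → ∀ m n : ℕ,
        𝒱.prod (m : ℤ) a (𝒱.prod (n : ℤ) b c)
            - psgn pa pb • 𝒱.prod (n : ℤ) b (𝒱.prod (m : ℤ) a c)
          = ∑ᶠ i : ℕ, zbinom (m : ℤ) i •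
              𝒱.prod ((m : ℤ) + (n : ℤ) - (i : ℤ)) (𝒱.prod (i : ℤ) a b) c) := by
  refine ⟨𝒱.prod_T_left, fun a b n => ?_, fun _ _ _ _ ha hb n => 𝒱.skew_symmetry ha hb n,
    fun _ _ _ _ c ha hb m n => 𝒱.jacobi ha hb c m n⟩
  rw [𝒱.T_prod, 𝒱.prod_T_left]
  push_cast
  module
end
end

section
/- Let 𝒱 be a Γ/ℤ-graded Poisson vertex algebra with Hamiltonian operator H with real eigenvalues. Let 𝒱_{ħ,Γ} be the ℂ[ħ]-span of all a ∈ 𝒱 with ε_a = 0, let {a,b}_ħ = Σ_{j≥0} C(γ_a−1, j) ħ^j a_(j)b be the ħ-bracket, and let J_{ħ,Γ} ⊂ 𝒱_{ħ,Γ} be the ℂ[ħ]-submodule generated by all elements a_(−2+χ(a,b),ħ,Γ)b with ε_a + ε_b ∈ ℤ, where a_(−2,ħ,Γ)b = ((T+ħH′)a)·b and a_(−1,ħ,Γ)b = a·b. Then J_{ħ,Γ} is a two-sided ideal of 𝒱_{ħ,Γ} with respect to both the commutative associative product and the ħ-bracket, and Zhu_{ħ,Γ}𝒱 := 𝒱_{ħ,Γ}/J_{ħ,Γ}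 is a Poisson superalgebra over ℂ[ħ], with commutative associative product induced by the product of 𝒱 and Lie bracket induced by {·,·}_ħ; moreover, the Jacobi identity {a,{b,c}_ħ}_ħ − p(a,b){b,{a,c}_ħ}_ħ = {{a,b}_ħ, c}_ħ holds already in 𝒱_{ħ,Γ} for a,b,c ∈ 𝒱_Γ. -/
noncomputable section

namespace Stmt18

/-- The Koszul sign `p(a,b) = (-1)^{p(a)p(b)}`. -/
def psgn (p q : ZMod 2) : ℂ := (-1 : ℂ) ^ (p.val * q.val)

/-- A Poisson vertex (super)algebra: a Lie conformal superalgebra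
`(𝒱, T, {·_λ·})` (with `{a_λ b} = Σ_{n≥0} (λⁿ/n!) br n a b`) which is also a unital
commutative associative differential superalgebra, the two structures being related
by the Leibniz rules. -/
structure PoissonVA (V : Type*) [AddCommGroup V] [Module ℂ V] where
  par : Module.End ℂ V
  par_invol : par * par = 1
  vac : V
  vac_even : par vac = vac
  T : Module.End ℂ V
  mul : V →ₗ[ℂ] V →ₗ[ℂ] V
  br : ℕ → V →ₗ[ℂ] V →ₗ[ℂ] V
  mul_par : ∀ a b, mul (par a) (par b) = par (mul a b)
  br_par : ∀ n a b, br n (par a) (par b) = par (br n a b)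
  one_mul' : ∀ a, mul vac a = a
  mul_comm' : ∀ (pa pb : ZMod 2) (a b : V),
    par a = ((-1 : ℂ) ^ pa.val) • a → par b = ((-1 : ℂ) ^ pb.val) • b →
    mul a b = psgn pa pb • mul b a
  mul_assoc' : ∀ a b c, mul (mul a b) c = mul a (mul b c)
  T_der : ∀ a b, T (mul a b) = mul (T a) b + mul a (T b)
  trunc : ∀ a b, ∃ N : ℕ, ∀ n, N ≤ n → br n a b = 0
  sesq₀ : ∀ a b, br 0 (T a) b = 0
  sesq : ∀ (n : ℕ) a b, br (n + 1) (T a) b = (-(n : ℂ) - 1) • br n a b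
  sesqT : ∀ (n : ℕ) a b, T (br n a b) = br n (T a) b + br n a (T b)
  skew : ∀ (pa pb : ZMod 2) (a b : V),
    par a = ((-1 : ℂ) ^ pa.val) • a → par b = ((-1 : ℂ) ^ pb.val) • b → ∀ n : ℕ,
    br n b a = - psgn pa pb • ∑ᶠ j : ℕ,
      ((-1 : ℂ) ^ (n + j) * ((Nat.factorial j : ℂ))⁻¹) • ((T ^ j) (br (n + j) a b))
  jacobi : ∀ (pa pb : ZMod 2) (a b c : V),
    par a = ((-1 : ℂ) ^ pa.val) • a → par b = ((-1 : ℂ) ^ pb.val) • b → ∀ m n : ℕ,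
    br m a (br n b c) - psgn pa pb • br n b (br m a c)
      = ∑ j ∈ Finset.range (m + 1), (m.choose j : ℂ) • br (m + n - j) (br j a b) c
  leibniz : ∀ (pa pb : ZMod 2) (a b : V),
    par a = ((-1 : ℂ) ^ pa.val) • a → par b = ((-1 : ℂ) ^ pb.val) • b →
    ∀ (n : ℕ) (c : V),
    br n a (mul b c) = mul (br n a b) c + psgn pa pb • mul b (br n a c)
  leibnizR : ∀ (pa pb : ZMod 2) (a b : V),
    par a = ((-1 : ℂ) ^ pa.val) • a → par b = ((-1 : ℂ) ^ pb.val) • b →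
    ∀ (m : ℕ) (c : V),
    br m (mul a b) c
      = ∑ᶠ j : ℕ, ((Nat.factorial j : ℂ))⁻¹ •
          (mul ((T ^ j) a) (br (m + j) b c)
            + psgn pa pb • mul ((T ^ j) b) (br (m + j) a c))

variable {V : Type*} [AddCommGroup V] [Module ℂ V]

/-- `binomOp H j = C(H, j)`. -/
def binomOp (H : Module.End ℂ V) : ℕ → Module.End ℂ V
  | 0 => 1
  | (j+1) => (((j : ℂ) + 1)⁻¹) • ((H - (j : ℂ) • 1) * binomOp H j)

def eps (Δ γ : ℝ) : ℝ := -Int.fract (Δ - γ)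
def gam (Δ γ : ℝ) : ℝ := Δ + eps Δ γ
def chiz (e₁ e₂ : ℝ) : ℤ := if e₁ + e₂ ≤ -1 then 1 else 0

/-- We realize `𝒱[ħ]` as functions `ℕ → V`. -/
def ofV (v : V) : ℕ → V := fun k => if k = 0 then v else 0

/-- multiplication by `ħ` -/
def hshift (f : ℕ → V) : ℕ → V := fun k => match k with
  | 0 => 0
  | (k+1) => f k

variable (𝒱 : PoissonVA V) (H' : Module.End ℂ V)

/-- the `ℂ[ħ]`-bilinear extension of the commutative product to `𝒱[ħ]` -/
def mulh (f g : ℕ → V) : ℕ → V := fun k =>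
  ∑ i ∈ Finset.range (k + 1), 𝒱.mul (f i) (g (k - i))

/-- the `ℂ[ħ]`-bilinear extension of the ħ-bracket
`{a,b}_ħ = Σ_{j≥0} C(γ_a - 1, j) ħ^j a_(j)b` to `𝒱[ħ]`,
written via the operator `C(H' - 1, j)`. -/
def hbrh (f g : ℕ → V) : ℕ → V := fun k =>
  ∑ i ∈ Finset.range (k + 1), ∑ l ∈ Finset.range (k + 1 - i),
    𝒱.br l (binomOp (H' - 1) l (f i)) (g (k - i - l))

/-- the generator `a_(-2+χ(a,b),ħ,Γ) b ∈ 𝒱[ħ]`, where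
`a_(-2,ħ,Γ) b = ((T + ħH')a)·b` and `a_(-1,ħ,Γ) b = a·b` -/
def genJ (e₁ e₂ : ℝ) (a b : V) : ℕ → V :=
  if chiz e₁ e₂ = 1 then ofV (𝒱.mul a b)
  else fun k => if k = 0 then 𝒱.mul (𝒱.T a) b
    else if k = 1 then 𝒱.mul (H' a) b else 0

variable (G : ℝ → ℝ → Submodule ℂ V)

/-- `J_{ħ,Γ}`: the `ℂ[ħ]`-submodule generated by the elements
`a_(-2+χ(a,b),ħ,Γ) b`, for homogeneous `a, b` with `ε_a + ε_b ∈ ℤ`. -/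
def JΓ : Submodule ℂ (ℕ → V) :=
  Submodule.span ℂ {x | ∃ (m : ℕ) (Δ₁ γ₁ Δ₂ γ₂ : ℝ) (a b : V) (k : ℤ),
    a ∈ G Δ₁ γ₁ ∧ b ∈ G Δ₂ γ₂ ∧ eps Δ₁ γ₁ + eps Δ₂ γ₂ = (k : ℝ) ∧
    x = hshift^[m] (genJ 𝒱 H' (eps Δ₁ γ₁) (eps Δ₂ γ₂) a b)}

/-- `𝒱_{ħ,Γ}`: the `ℂ[ħ]`-span of the homogeneous `a ∈ 𝒱` with `ε_a = 0`. -/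
def VΓh : Submodule ℂ (ℕ → V) :=
  Submodule.span ℂ {x | ∃ (m : ℕ) (Δ γ : ℝ) (a : V),
    a ∈ G Δ γ ∧ eps Δ γ = 0 ∧ x = hshift^[m] (ofV a)}

section Grading

/-- Indices of the simultaneous grading of `𝒱`: the conformal weight `Δ`, the class of `Δ - γ`
in `ℝ/ℤ`, and the parity. -/
abbrev Idx := ℝ × AddCircle (1 : ℝ) × ZMod 2

/-- The value of `ε` on a class of `ℝ/ℤ`: its maximal non-positive representative, up to sign. -/
def epsC (q : AddCircle (1 : ℝ)) : ℝ := -(AddCircle.equivIco 1 0 q : ℝ)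

/-- The eigenvalue `γ = Δ + ε` of `H'`. -/
def gamI (i : Idx) : ℝ := i.1 + epsC i.2.1

/-- The index of weight `n`, trivial class and even parity. -/
def wt (n : ℕ) : Idx := ((n : ℝ), 0, 0)

/-- A simultaneous grading of a Poisson vertex algebra by weight, class and parity. -/
structure IsGrading (A : Idx → Submodule ℂ V) : Prop where
  indep : iSupIndep A
  span : ⨆ i, A i = ⊤
  mul_mem : ∀ {i j : Idx} {a b : V}, a ∈ A i → b ∈ A j → 𝒱.mul a b ∈ A (i + j)
  br_mem : ∀ (n : ℕ) {i j : Idx} {a b : V}, a ∈ A i → b ∈ A j →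
    𝒱.br n a b ∈ A (i + j - wt (n + 1))
  eigen : ∀ {i : Idx} {a : V}, a ∈ A i → H' a = ((gamI i : ℝ) : ℂ) • a
  par_eq : ∀ {i : Idx} {a : V}, a ∈ A i → 𝒱.par a = ((-1 : ℂ) ^ i.2.2.val) • a
  vac_mem : 𝒱.vac ∈ A 0

/-- The homogeneous component of `𝒱` attached to an index. -/
def homog (i : Idx) : Submodule ℂ V :=
  G i.1 (gamI i) ⊓ LinearMap.ker (𝒱.par - ((-1 : ℂ) ^ i.2.2.val) • 1)

lemma epsC_coe (x : ℝ) : epsC (x : AddCircle (1 : ℝ)) = -Int.fract x := by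
  have := AddCircle.coe_equivIco_mk_apply (p := (1 : ℝ)) x
  simp only [div_one, mul_one] at this
  rw [epsC, ← this]

lemma epsC_zero : epsC 0 = 0 := by
  have := epsC_coe 0
  simpa using this

lemma epsC_injective : Function.Injective epsC := by
  intro q r h
  rw [epsC, epsC, neg_inj] at h
  exact (AddCircle.equivIco 1 0).injective (Subtype.ext h)

lemma gamI_sub_wt (i : Idx) (n : ℕ) : gamI (i - wt n) = gamI i - n := by
  simp [gamI, wt]; ring

lemma gamI_add_wt (i : Idx) (n : ℕ) : gamI (i + wt n) = gamI i + n := by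
  simp [gamI, wt]; ring

lemma gamI_add {i : Idx} (hi : i.2.1 = 0) (j : Idx) : gamI (i + j) = gamI i + gamI j := by
  simp [gamI, hi, epsC_zero]; ring

lemma zmod_two_cases (p : ZMod 2) : p = 0 ∨ p = 1 := by
  fin_cases p
  · exact Or.inl rfl
  · exact Or.inr rfl

lemma neg_one_pow_val_add (p q : ZMod 2) :
    (-1 : ℂ) ^ (p + q).val = (-1) ^ p.val * (-1) ^ q.val := by
  rcases zmod_two_cases p with rfl | rfl <;> rcases zmod_two_cases q with rfl | rfl <;>
    simp [ZMod.val_one, show (1 + 1 : ZMod 2) = 0 from rfl]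

lemma G_add_int (hper : ∀ Δ γ : ℝ, G Δ (γ + 1) = G Δ γ) (Δ γ : ℝ) (n : ℤ) :
    G Δ (γ + n) = G Δ γ := by
  induction n using Int.induction_on with
  | zero => simp
  | succ k ih => rw [← ih, ← hper Δ (γ + (k : ℤ))]; push_cast; ring_nf
  | pred k ih => rw [← ih, ← hper Δ (γ + (-(k : ℤ) - 1 : ℤ))]; push_cast; ring_nf

lemma gamI_mk (Δ γ : ℝ) (p : ZMod 2) :
    gamI (Δ, ((Δ - γ : ℝ) : AddCircle (1 : ℝ)), p) = γ + ⌊Δ - γ⌋ := by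
  simp only [gamI, epsC_coe, Int.fract]; ring

lemma coe_sub_gamI (i : Idx) : ((i.1 - gamI i : ℝ) : AddCircle (1 : ℝ)) = i.2.1 := by
  simp only [gamI, epsC, sub_add_cancel_left, neg_neg]
  exact AddCircle.coe_equivIco

lemma eps_gamI (i : Idx) : eps i.1 (gamI i) = epsC i.2.1 := by
  rw [eps, ← epsC_coe, coe_sub_gamI]

lemma mem_homog (hper : ∀ Δ γ : ℝ, G Δ (γ + 1) = G Δ γ) {Δ γ : ℝ} {p : ZMod 2} {a : V}
    (ha : a ∈ G Δ γ) (hp : 𝒱.par a = ((-1 : ℂ) ^ p.val) • a) :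
    a ∈ homog 𝒱 G (Δ, ((Δ - γ : ℝ) : AddCircle (1 : ℝ)), p) := by
  refine ⟨?_, by simp [hp]⟩
  rw [gamI_mk, G_add_int G hper]
  exact ha

lemma homog_par {i : Idx} {a : V} (ha : a ∈ homog 𝒱 G i) :
    𝒱.par a = ((-1 : ℂ) ^ i.2.2.val) • a := by
  have := ha.2
  simpa [sub_eq_zero] using this

lemma par_par (x : V) : 𝒱.par (𝒱.par x) = x := by
  have := congrArg (fun f => f x) 𝒱.par_invol
  simpa using this

/-- Parity components of a vector. -/
lemma exists_parity_parts (S : Submodule ℂ V) (hS : ∀ a ∈ S, 𝒱.par a ∈ S) {a : V} (ha : a ∈ S) :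
    ∃ b : ZMod 2 → V, (∀ p, b p ∈ S) ∧ (∀ p, 𝒱.par (b p) = ((-1 : ℂ) ^ p.val) • b p) ∧
      a = b 0 + b 1 := by
  refine ⟨fun p => (2⁻¹ : ℂ) • (a + ((-1 : ℂ) ^ p.val) • 𝒱.par a), fun p => ?_, fun p => ?_, ?_⟩
  · exact S.smul_mem _ (S.add_mem ha (S.smul_mem _ (hS a ha)))
  · rcases zmod_two_cases p with rfl | rfl
    · simp [par_par, add_comm]
    · simp [par_par, ZMod.val_one, ← sub_eq_add_neg]
      rw [← smul_neg, neg_sub]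
  · simp only [ZMod.val_zero, pow_zero, one_smul, ZMod.val_one, pow_one, neg_smul, ← smul_add]
    rw [show a + 𝒱.par a + (a + -𝒱.par a) = (2 : ℂ) • a by rw [two_smul]; abel, smul_smul]
    norm_num

lemma iSup_homog (hper : ∀ Δ γ : ℝ, G Δ (γ + 1) = G Δ γ)
    (hspan : (⨆ (Δ : ℝ) (γ : ℝ), G Δ γ) = ⊤)
    (hpar : ∀ Δ γ : ℝ, ∀ a ∈ G Δ γ, 𝒱.par a ∈ G Δ γ) : ⨆ i, homog 𝒱 G i = ⊤ := by
  rw [eq_top_iff, ← hspan, iSup_le_iff]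
  intro Δ
  rw [iSup_le_iff]
  intro γ a ha
  obtain ⟨b, hb, hbp, rfl⟩ := exists_parity_parts 𝒱 (G Δ γ) (hpar Δ γ) ha
  exact add_mem (Submodule.mem_iSup_of_mem _ (mem_homog 𝒱 G hper (hb 0) (hbp 0)))
    (Submodule.mem_iSup_of_mem _ (mem_homog 𝒱 G hper (hb 1) (hbp 1)))

lemma homog_eigen (hH' : ∀ Δ γ : ℝ, ∀ a ∈ G Δ γ, H' a = ((gam Δ γ : ℝ) : ℂ) • a)
    {i : Idx} {a : V} (ha : a ∈ homog 𝒱 G i) : H' a = ((gamI i : ℝ) : ℂ) • a := by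
  have := hH' _ _ a ha.1
  rwa [gam, eps_gamI] at this

lemma commute_of_eigen {ι : Type*} {A : ι → Submodule ℂ V} (hA : ⨆ i, A i = ⊤)
    {f g : Module.End ℂ V} {c d : ι → ℂ} (hf : ∀ i, ∀ a ∈ A i, f a = c i • a)
    (hg : ∀ i, ∀ a ∈ A i, g a = d i • a) : Commute f g := by
  refine LinearMap.ext fun x => ?_
  have hx : x ∈ ⨆ i, A i := hA ▸ Submodule.mem_top
  induction hx using Submodule.iSup_induction' with
  | mem i x hx => simp [hf i x hx, hg i x hx, smul_comm (c i)]
  | zero => simp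
  | add x y _ _ hx hy => simp only [map_add, hx, hy]

lemma iSupIndep_of_eigen {ι κ : Type*} {A : ι → Submodule ℂ V} (hA : ⨆ i, A i = ⊤)
    (f : κ → Module.End ℂ V) (c : ι → κ → ℂ) (hc : Function.Injective c)
    (hf : ∀ k i, ∀ a ∈ A i, f k a = c i k • a) : iSupIndep A := by
  have h := Module.End.independent_iInf_maxGenEigenspace_of_forall_mapsTo f
    fun i j φ => Module.End.mapsTo_maxGenEigenspace_of_comm
      (commute_of_eigen hA (hf j) (hf i)) φ
  refine (h.comp hc).mono fun i a ha => ?_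
  simp only [Function.comp, Submodule.mem_iInf]
  intro k
  refine Module.End.mem_maxGenEigenspace _ _ _ |>.2 ⟨1, ?_⟩
  simp [hf k i a ha]

lemma iSupIndep_homog (hspan : ⨆ i, homog 𝒱 G i = ⊤) (H : Module.End ℂ V)
    (heig : ∀ Δ γ : ℝ, ∀ a ∈ G Δ γ, H a = ((Δ : ℝ) : ℂ) • a)
    (hH' : ∀ Δ γ : ℝ, ∀ a ∈ G Δ γ, H' a = ((gam Δ γ : ℝ) : ℂ) • a) :
    iSupIndep (homog 𝒱 G) := by
  refine iSupIndep_of_eigen hspan ![H, H', 𝒱.par]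
    (fun i => ![((i.1 : ℝ) : ℂ), ((gamI i : ℝ) : ℂ), (-1 : ℂ) ^ i.2.2.val]) ?_ ?_
  · rintro ⟨Δ, q, p⟩ ⟨Δ', q', p'⟩ h
    have h0 := congrFun h 0
    have h1 := congrFun h 1
    have h2 := congrFun h 2
    simp only [Matrix.cons_val, Complex.ofReal_inj, gamI] at h0 h1 h2
    subst h0
    have hq := epsC_injective (add_left_cancel h1)
    subst hq
    have : p = p' := by
      rcases zmod_two_cases p with rfl | rfl <;> rcases zmod_two_cases p' with rfl | rfl
      · rfl
      · norm_num [ZMod.val_one] at h2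
      · norm_num [ZMod.val_one] at h2
      · rfl
    rw [this]
  · intro k i a ha
    fin_cases k
    · exact heig _ _ a ha.1
    · exact homog_eigen 𝒱 H' G hH' ha
    · exact homog_par 𝒱 G ha

lemma isGrading_homog (H : Module.End ℂ V)
    (hper : ∀ Δ γ : ℝ, G Δ (γ + 1) = G Δ γ)
    (hspan : (⨆ (Δ : ℝ) (γ : ℝ), G Δ γ) = ⊤)
    (heig : ∀ Δ γ : ℝ, ∀ a ∈ G Δ γ, H a = ((Δ : ℝ) : ℂ) • a)
    (hH' : ∀ Δ γ : ℝ, ∀ a ∈ G Δ γ, H' a = ((gam Δ γ : ℝ) : ℂ) • a)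
    (hvac : 𝒱.vac ∈ G 0 0)
    (hpar : ∀ Δ γ : ℝ, ∀ a ∈ G Δ γ, 𝒱.par a ∈ G Δ γ)
    (hmulmem : ∀ (Δ₁ γ₁ Δ₂ γ₂ : ℝ) (a b : V), a ∈ G Δ₁ γ₁ → b ∈ G Δ₂ γ₂ →
      𝒱.mul a b ∈ G (Δ₁ + Δ₂) (γ₁ + γ₂))
    (hbrmem : ∀ (n : ℕ) (Δ₁ γ₁ Δ₂ γ₂ : ℝ) (a b : V), a ∈ G Δ₁ γ₁ → b ∈ G Δ₂ γ₂ →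
      𝒱.br n a b ∈ G (Δ₁ + Δ₂ - n - 1) (γ₁ + γ₂)) :
    IsGrading 𝒱 H' (homog 𝒱 G) where
  indep := iSupIndep_homog 𝒱 H' G (iSup_homog 𝒱 G hper hspan hpar) H heig hH'
  span := iSup_homog 𝒱 G hper hspan hpar
  mul_mem {i j a b} ha hb := by
    have h := mem_homog 𝒱 G hper (p := i.2.2 + j.2.2) (hmulmem _ _ _ _ a b ha.1 hb.1) (by
      rw [← 𝒱.mul_par, homog_par 𝒱 G ha, homog_par 𝒱 G hb, neg_one_pow_val_add]
      simp [smul_smul, mul_comm])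
    convert h using 2
    refine Prod.ext rfl (Prod.ext ?_ rfl)
    change i.2.1 + j.2.1 = _
    rw [← coe_sub_gamI i, ← coe_sub_gamI j, ← AddCircle.coe_add]
    congr 1; ring
  br_mem n {i j a b} ha hb := by
    have h := mem_homog 𝒱 G hper (p := i.2.2 + j.2.2) (hbrmem n _ _ _ _ a b ha.1 hb.1) (by
      rw [← 𝒱.br_par, homog_par 𝒱 G ha, homog_par 𝒱 G hb, neg_one_pow_val_add]
      simp [smul_smul, mul_comm])
    convert h using 2
    refine Prod.ext ?_ (Prod.ext ?_ ?_)
    · simp [wt]; ring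
    · change i.2.1 + j.2.1 - 0 = _
      rw [← coe_sub_gamI i, ← coe_sub_gamI j, sub_zero, ← AddCircle.coe_add,
        show i.1 + j.1 - (n : ℝ) - 1 - (gamI i + gamI j)
          = (i.1 - gamI i + (j.1 - gamI j)) - ((n + 1 : ℕ) : ℝ) by push_cast; ring,
        AddCircle.coe_sub]
      have : (((n + 1 : ℕ) : ℝ) : AddCircle (1 : ℝ)) = 0 := by
        have := AddCircle.coe_eq_zero_iff (1 : ℝ) (x := ((n + 1 : ℕ) : ℝ))
        exact this.2 ⟨(n + 1 : ℕ), by simp⟩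
      rw [this, sub_zero]
    · simp [wt]
  eigen ha := homog_eigen 𝒱 H' G hH' ha
  par_eq ha := homog_par 𝒱 G ha
  vac_mem := by
    have h := mem_homog 𝒱 G hper (p := 0) hvac (by simp [𝒱.vac_even])
    convert h using 2
    refine Prod.ext rfl (Prod.ext ?_ rfl)
    simp

end Grading

section Centre

variable {𝒱}

lemma parity_induction (𝒱 : PoissonVA V) {P : V → Prop} (S : Submodule ℂ V)
    (hS : ∀ a ∈ S, 𝒱.par a ∈ S)
    (h : ∀ (q : ZMod 2) (a : V), a ∈ S → 𝒱.par a = ((-1 : ℂ) ^ q.val) • a → P a)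
    (hadd : ∀ a b, P a → P b → P (a + b)) {a : V} (ha : a ∈ S) : P a := by
  obtain ⟨b, hb, hbp, rfl⟩ := exists_parity_parts 𝒱 S hS ha
  exact hadd _ _ (h 0 _ (hb 0) (hbp 0)) (h 1 _ (hb 1) (hbp 1))

/-- The operator `x ↦ p(c,x) x` for `c` of parity `p`. -/
def twist (𝒱 : PoissonVA V) (p : ZMod 2) : Module.End ℂ V := 𝒱.par ^ p.val

lemma twist_apply {p q : ZMod 2} {a : V} (ha : 𝒱.par a = ((-1 : ℂ) ^ q.val) • a) :
    twist 𝒱 p a = psgn p q • a := by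
  rcases zmod_two_cases p with rfl | rfl <;> simp [twist, psgn, ZMod.val_one, ha]

/-- The left Leibniz rule with an arbitrary first factor. -/
lemma br_mul {p : ZMod 2} {c : V} (hc : 𝒱.par c = ((-1 : ℂ) ^ p.val) • c) (n : ℕ) (x y : V) :
    𝒱.br n c (𝒱.mul x y) = 𝒱.mul (𝒱.br n c x) y + 𝒱.mul (twist 𝒱 p x) (𝒱.br n c y) := by
  refine parity_induction 𝒱 (P := fun x => 𝒱.br n c (𝒱.mul x y)
      = 𝒱.mul (𝒱.br n c x) y + 𝒱.mul (twist 𝒱 p x) (𝒱.br n c y)) ⊤ (fun _ _ => trivial)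
    (fun q a _ ha => ?_) (fun a b ha hb => ?_) (Submodule.mem_top (x := x))
  · rw [𝒱.leibniz p q c a hc ha, twist_apply ha]
    simp
  · simp only [map_add, LinearMap.add_apply, ha, hb]
    abel

/-- Left and right central elements coincide. -/
lemma central_iff (x : V) : (∀ n b, 𝒱.br n b x = 0) ↔ ∀ n b, 𝒱.br n x b = 0 := by
  constructor
  · intro hx n b
    let S : Submodule ℂ V :=
      { carrier := {x | ∀ n b, 𝒱.br n b x = 0}
        add_mem' := fun h h' n b => by simp [h n b, h' n b]
        zero_mem' := by simp
        smul_mem' := fun c x h n b => by simp [h n b] }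
    refine parity_induction 𝒱 (P := fun x => 𝒱.br n x b = 0) S (fun a ha n b => ?_)
      (fun q a ha haq => ?_) (fun a b ha hb => by simp [ha, hb]) hx
    · rw [← par_par 𝒱 b, 𝒱.br_par, ha, map_zero]
    · refine parity_induction 𝒱 (P := fun b => 𝒱.br n a b = 0) ⊤ (fun _ _ => trivial)
        (fun r b _ hb => ?_) (fun b b' h h' => by simp [h, h']) (Submodule.mem_top (x := b))
      rw [𝒱.skew r q b a hb haq n]
      simp [ha _ b]
  · intro hx n b
    let S : Submodule ℂ V :=
      { carrier := {x | ∀ n b, 𝒱.br n x b = 0}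
        add_mem' := fun h h' n b => by simp [h n b, h' n b]
        zero_mem' := by simp
        smul_mem' := fun c x h n b => by simp [h n b] }
    refine parity_induction 𝒱 (P := fun x => 𝒱.br n b x = 0) S (fun a ha n b => ?_)
      (fun q a ha haq => ?_) (fun a b ha hb => by simp [ha, hb]) hx
    · rw [← par_par 𝒱 b, 𝒱.br_par, ha, map_zero]
    · refine parity_induction 𝒱 (P := fun b => 𝒱.br n b a = 0) ⊤ (fun _ _ => trivial)
        (fun r b _ hb => ?_) (fun b b' h h' => by simp [h, h']) (Submodule.mem_top (x := b))
      rw [𝒱.skew q r a b haq hb n]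
      simp [ha _ b]

lemma eq_zero_of_pascal {M : Type*} [AddCommGroup M] (F : ℕ → ℕ → M)
    (hF : ∀ k r, F (k + 1) r = F k (r + 1) + F k r) (K R : ℕ)
    (hK : ∀ k, K ≤ k → F k 0 = 0) (hR : ∀ r, R ≤ r → F 0 r = 0) : F 0 0 = 0 := by
  have h1 : ∀ r k, K ≤ k → F k r = 0 := by
    intro r
    induction r with
    | zero => exact hK
    | succ r ih =>
      intro k hk
      have := hF k r
      rwa [ih _ hk, ih _ (by omega), add_zero, eq_comm] at this
  have h2 : ∀ k r, R ≤ r → F k r = 0 := by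
    intro k
    induction k with
    | zero => exact hR
    | succ k ih => intro r hr; rw [hF, ih _ hr, ih _ (by omega), add_zero]
  have h3 : ∀ s k, K ≤ k + s → ∀ r, F k r = 0 := by
    intro s
    induction s with
    | zero => intro k hk r; exact h1 r k hk
    | succ s ih =>
      intro k hk
      have h4 : ∀ t r, R ≤ r + t → F k r = 0 := by
        intro t
        induction t with
        | zero => intro r hr; exact h2 k r hr
        | succ t iht =>
          intro r hr
          have := hF k r
          rwa [ih (k + 1) (by omega), iht (r + 1) (by omega), zero_add, eq_comm] at this
      exact fun r => h4 R r (by omega)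
  exact h3 K 0 (by omega) 0

/-- `{c_λ Tb} = (T + λ){c_λ b}` in terms of divided powers of `λ`. -/
lemma divided_br_T (n : ℕ) (c b : V) :
    (((n + 1).factorial : ℂ)⁻¹) • 𝒱.br (n + 1) c (𝒱.T b)
      = 𝒱.T ((((n + 1).factorial : ℂ)⁻¹) • 𝒱.br (n + 1) c b)
        + ((n.factorial : ℂ)⁻¹) • 𝒱.br n c b := by
  have h := 𝒱.sesqT (n + 1) c b
  rw [𝒱.sesq] at h
  have h' : 𝒱.br (n + 1) c (𝒱.T b) = 𝒱.T (𝒱.br (n + 1) c b) + ((n : ℂ) + 1) • 𝒱.br n c b := by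
    rw [h]; module
  rw [h', map_smul, smul_add, smul_smul, Nat.factorial_succ]
  congr 2
  have h1 : ((n : ℂ) + 1) ≠ 0 := Nat.cast_add_one_ne_zero n
  have h2 : (n.factorial : ℂ) ≠ 0 := Nat.cast_ne_zero.2 (Nat.factorial_ne_zero n)
  push_cast
  field_simp

variable {D : Module.End ℂ V}

lemma twist_mul_br_eq_zero (hD : ∀ a b, D (𝒱.mul a b) = 𝒱.mul (D a) b + 𝒱.mul a (D b))
    (hDbr : ∀ n c a, 𝒱.br n c (D a) = 0) {p : ZMod 2} {c : V}
    (hc : 𝒱.par c = ((-1 : ℂ) ^ p.val) • c) (n : ℕ) (a b : V) :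
    𝒱.mul (twist 𝒱 p (D a)) (𝒱.br n c b) = 0 := by
  have key : ∀ n b, 𝒱.mul (twist 𝒱 p (D a)) (𝒱.br n c b) + 𝒱.mul (𝒱.br n c a) (D b) = 0 := by
    intro n b
    have h := hDbr n c (𝒱.mul a b)
    rw [hD, map_add, br_mul hc, br_mul hc, hDbr, hDbr] at h
    simpa using h
  obtain ⟨N, hN⟩ := 𝒱.trunc c a
  obtain ⟨M, hM⟩ := 𝒱.trunc c b
  have h := eq_zero_of_pascal (fun k r => 𝒱.mul (twist 𝒱 p (D a))
    ((𝒱.T ^ r) (((n + k + r).factorial : ℂ)⁻¹ • 𝒱.br (n + k + r) c ((𝒱.T ^ k) b))))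
    (fun k r => by
      have := divided_br_T (𝒱 := 𝒱) (n + k + r) c ((𝒱.T ^ k) b)
      rw [← Module.End.mul_apply 𝒱.T, ← pow_succ'] at this
      rw [show n + (k + 1) + r = n + k + r + 1 by ring, this,
        show n + k + (r + 1) = n + k + r + 1 by ring, map_add, map_add, pow_succ 𝒱.T r,
        Module.End.mul_apply]) N M
    (fun k hk => by
      have := key (n + k) ((𝒱.T ^ k) b)
      rw [hN _ (by omega), map_zero, LinearMap.zero_apply, add_zero] at this
      simp [this])
    (fun r hr => by simp [hM (n + r) (by omega)])
  have h2 : (n.factorial : ℂ)⁻¹ ≠ 0 :=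
    inv_ne_zero (Nat.cast_ne_zero.2 (Nat.factorial_ne_zero n))
  simpa [Nat.factorial_ne_zero] using h

/-- A derivation with central image annihilates all brackets. -/
lemma mul_br_eq_zero (hD : ∀ a b, D (𝒱.mul a b) = 𝒱.mul (D a) b + 𝒱.mul a (D b))
    (hDbr : ∀ n c a, 𝒱.br n c (D a) = 0) (n : ℕ) (a b c : V) :
    𝒱.mul (D a) (𝒱.br n c b) = 0 := by
  refine parity_induction 𝒱 (P := fun c => 𝒱.mul (D a) (𝒱.br n c b) = 0) ⊤
    (fun _ _ => trivial) (fun p c _ hc => ?_)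
    (fun c c' h h' => by simp [h, h']) (Submodule.mem_top (x := c))
  rcases zmod_two_cases p with rfl | rfl
  · simpa [twist] using twist_mul_br_eq_zero hD hDbr hc n a b
  · have h := congrArg 𝒱.par (twist_mul_br_eq_zero hD hDbr hc n a (𝒱.par b))
    rw [← 𝒱.mul_par, ← 𝒱.br_par, hc, par_par] at h
    simpa [twist, par_par, ZMod.val_one] using h

lemma par_mul_br_eq_zero (hD : ∀ a b, D (𝒱.mul a b) = 𝒱.mul (D a) b + 𝒱.mul a (D b))
    (hDbr : ∀ n c a, 𝒱.br n c (D a) = 0) (p : ZMod 2) (n : ℕ) (a b c : V) :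
    𝒱.mul (twist 𝒱 p (D a)) (𝒱.br n c b) = 0 := by
  rcases zmod_two_cases p with rfl | rfl
  · simpa [twist] using mul_br_eq_zero hD hDbr n a b c
  · have h := congrArg 𝒱.par (mul_br_eq_zero hD hDbr n a (𝒱.par b) (𝒱.par c))
    rw [← 𝒱.mul_par, ← 𝒱.br_par, par_par, par_par, map_zero] at h
    simpa [twist, ZMod.val_one] using h

/-- The image of a derivation with central image generates a central ideal. -/
lemma br_mul_der_eq_zero (hD : ∀ a b, D (𝒱.mul a b) = 𝒱.mul (D a) b + 𝒱.mul a (D b))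
    (hDbr : ∀ n c a, 𝒱.br n c (D a) = 0) (n : ℕ) (a b c : V) :
    𝒱.br n c (𝒱.mul (D a) b) = 0 := by
  refine parity_induction 𝒱 (P := fun c => 𝒱.br n c (𝒱.mul (D a) b) = 0) ⊤
    (fun _ _ => trivial) (fun p c _ hc => ?_)
    (fun c c' h h' => by simp [h, h']) (Submodule.mem_top (x := c))
  rw [br_mul hc, hDbr, par_mul_br_eq_zero hD hDbr]
  simp

end Centre

section Projections

variable {𝒱 H'} {A : Idx → Submodule ℂ V}

@[elab_as_elim]
lemma IsGrading.induction (hA : IsGrading 𝒱 H' A) {P : V → Prop}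
    (h : ∀ i, ∀ a ∈ A i, P a) (hadd : ∀ a b, P a → P b → P (a + b)) (x : V) : P x :=
  Submodule.iSup_induction A (motive := P) (hA.span ▸ Submodule.mem_top : x ∈ ⨆ i, A i) h
    (h 0 0 (Submodule.zero_mem _)) hadd

open Classical in
lemma IsGrading.exists_linearMap (hA : IsGrading 𝒱 H' A) (f : Idx → Module.End ℂ V) :
    ∃ g : Module.End ℂ V, ∀ i, ∀ a ∈ A i, g a = f i a := by
  have hint := DirectSum.isInternal_submodule_of_iSupIndep_of_iSup_eq_top hA.indep hA.span
  let e := LinearEquiv.ofBijective (DirectSum.coeLinearMap A) hint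
  refine ⟨(DirectSum.toModule ℂ Idx V fun i => (f i).comp (A i).subtype) ∘ₗ e.symm.toLinearMap,
    fun i a ha => ?_⟩
  have : e.symm a = DirectSum.lof ℂ Idx (fun i => A i) i ⟨a, ha⟩ := by
    rw [LinearEquiv.symm_apply_eq]
    exact (DirectSum.coeLinearMap_lof A i ⟨a, ha⟩).symm
  simp [this]

/-- The projections onto the components of a grading. -/
structure IsProj (A : Idx → Submodule ℂ V) (π : Idx → Module.End ℂ V) : Prop where
  mem : ∀ i x, π i x ∈ A i
  self : ∀ {i x}, x ∈ A i → π i x = x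
  of_ne : ∀ {i j x}, x ∈ A i → i ≠ j → π j x = 0

open Classical in
lemma IsGrading.exists_isProj (hA : IsGrading 𝒱 H' A) : ∃ π, IsProj A π := by
  choose π hπ using fun j => hA.exists_linearMap fun i => if i = j then 1 else 0
  refine ⟨π, fun i x => ?_, fun ha => ?_, fun ha hij => ?_⟩
  · refine hA.induction (fun j a ha => ?_) (fun a b ha hb => ?_) x
    · rw [hπ i j a ha]
      split_ifs with h
      · exact h ▸ ha
      · simp
    · rw [map_add]
      exact add_mem ha hb
  · simp [hπ _ _ _ ha]
  · simp [hπ _ _ _ ha, hij]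

variable {π : Idx → Module.End ℂ V}

lemma IsProj.eq_zero (hA : IsGrading 𝒱 H' A) (hπ : IsProj A π) {x : V} (hx : ∀ i, π i x = 0) :
    x = 0 := by
  classical
  obtain ⟨f, hf, rfl⟩ := (Submodule.mem_iSup_iff_exists_finsupp A x).1
    (hA.span ▸ Submodule.mem_top)
  refine Finset.sum_eq_zero fun i hi => ?_
  have h := hx i
  rw [map_finsuppSum, Finsupp.sum, Finset.sum_eq_single i, hπ.self (hf i)] at h
  · exact h
  · intro j _ hj
    exact hπ.of_ne (hf j) hj
  · intro hi
    simp [Finsupp.notMem_support_iff.1 hi]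

lemma IsProj.map_shift (hA : IsGrading 𝒱 H' A) (hπ : IsProj A π) {F : Module.End ℂ V} {s : Idx}
    (hF : ∀ i, ∀ a ∈ A i, F a ∈ A (i + s)) (k : Idx) (x : V) :
    π (k + s) (F x) = F (π k x) := by
  refine hA.induction (fun i a ha => ?_) (fun a b ha hb => by simp only [map_add, ha, hb]) x
  rcases eq_or_ne i k with rfl | h
  · rw [hπ.self ha, hπ.self (hF i a ha)]
  · rw [hπ.of_ne ha h, hπ.of_ne (hF i a ha) (by simpa using h), map_zero]

lemma wt_zero : wt 0 = 0 := by
  simp only [wt, Nat.cast_zero]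
  rfl

lemma wt_succ (n : ℕ) : wt (n + 1) = wt n + wt 1 := by
  simp [wt]

variable (𝒱 A) in
/-- `D` is a derivation of weight one with the same brackets as `T`. -/
structure IsGradedDer (D : Module.End ℂ V) : Prop where
  mem : ∀ {i a}, a ∈ A i → D a ∈ A (i + wt 1)
  der : ∀ a b, D (𝒱.mul a b) = 𝒱.mul (D a) b + 𝒱.mul a (D b)
  central : ∀ n c a, 𝒱.br n c ((𝒱.T - D) a) = 0

/-- The weight one part of `T` is a derivation with the same brackets as `T`. -/
lemma IsGrading.exists_isGradedDer (hA : IsGrading 𝒱 H' A) : ∃ D, IsGradedDer 𝒱 A D := by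
  obtain ⟨π, hπ⟩ := hA.exists_isProj
  obtain ⟨D, hD⟩ := hA.exists_linearMap fun i => π (i + wt 1) * 𝒱.T
  refine ⟨D, fun ha => hD _ _ ha ▸ hπ.mem _ _, fun a b => ?_, fun n c a => ?_⟩
  · refine hA.induction (fun i a ha => ?_) (fun a a' h h' => ?_) a
    · refine hA.induction (fun j b hb => ?_) (fun b b' h h' => ?_) b
      · rw [hD _ _ (hA.mul_mem ha hb), hD i a ha, hD j b hb, Module.End.mul_apply, 𝒱.T_der,
          map_add]
        congr 1
        · have := hπ.map_shift hA (F := 𝒱.mul.flip b) (s := j)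
            (fun i a ha => hA.mul_mem ha hb) (i + wt 1) (𝒱.T a)
          rw [add_right_comm] at this
          simpa using this
        · have := hπ.map_shift hA (F := 𝒱.mul a) (s := i)
            (fun j b hb => add_comm i j ▸ hA.mul_mem ha hb) (j + wt 1) (𝒱.T b)
          rw [add_right_comm, add_comm j i] at this
          simpa using this
      · simp only [map_add, h, h']
        abel
    · simp only [map_add, LinearMap.add_apply, h, h']
      abel
  · refine (central_iff _).2 (fun n b => ?_) n c
    rw [LinearMap.sub_apply, map_sub, LinearMap.sub_apply, sub_eq_zero]
    refine hA.induction (fun i a ha => ?_) (fun a a' h h' => ?_) a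
    · refine hA.induction (fun j b hb => ?_) (fun b b' h h' => ?_) b
      · have := hπ.map_shift hA (F := (𝒱.br n).flip b) (s := j - wt (n + 1))
            (fun i a ha => add_sub_assoc i j _ ▸ hA.br_mem n ha hb) (i + wt 1) (𝒱.T a)
        rw [hD i a ha]
        simp only [LinearMap.flip_apply, Module.End.mul_apply] at this ⊢
        rw [← this, hπ.self]
        cases n with
        | zero => rw [𝒱.sesq₀]; exact zero_mem _
        | succ n =>
          rw [𝒱.sesq]
          have e : i + wt 1 + (j - wt (n + 1 + 1)) = i + j - wt (n + 1) := by
            rw [wt_succ (n + 1)]; abel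
          rw [e]
          exact Submodule.smul_mem _ _ (hA.br_mem n ha hb)
      · simp only [map_add, h, h']
    · simp only [map_add, LinearMap.add_apply, h, h']

end Projections

section Polynomials

/-- The monomial `ħ^m v`. -/
def hmon (m : ℕ) : V →ₗ[ℂ] (ℕ → V) := LinearMap.single ℂ (fun _ : ℕ => V) m

lemma hmon_apply (m : ℕ) (v : V) (k : ℕ) : hmon m v k = if k = m then v else 0 := by
  simp [hmon, Pi.single_apply]

lemma ofV_eq_hmon (v : V) : ofV v = hmon 0 v := by
  ext k
  simp [ofV, hmon_apply]

lemma hshift_iterate_apply {W : Type*} [AddCommGroup W] (m : ℕ) (f : ℕ → W) (k : ℕ) :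
    hshift^[m] f k = if m ≤ k then f (k - m) else 0 := by
  induction m generalizing k with
  | zero => simp
  | succ m ih =>
    rw [Function.iterate_succ_apply']
    cases k with
    | zero => simp [hshift]
    | succ k => simp [hshift, ih]

lemma hshift_iterate_hmon (m k : ℕ) (v : V) : hshift^[m] (hmon k v) = hmon (m + k) v := by
  ext r
  rw [hshift_iterate_apply, hmon_apply, hmon_apply]
  split_ifs <;> first | rfl | omega

lemma hshift_iterate_add {W : Type*} [AddCommGroup W] (m : ℕ) (f g : ℕ → W) :
    hshift^[m] (f + g) = hshift^[m] f + hshift^[m] g := by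
  ext r
  simp only [hshift_iterate_apply, Pi.add_apply]
  split_ifs <;> simp

/-- The product of `𝒱[ħ]` as a bilinear map. -/
def mulₗ : (ℕ → V) →ₗ[ℂ] (ℕ → V) →ₗ[ℂ] (ℕ → V) :=
  LinearMap.mk₂ ℂ (mulh 𝒱)
    (fun _ _ _ => by ext; simp [mulh, Finset.sum_add_distrib])
    (fun _ _ _ => by ext; simp [mulh, Finset.smul_sum])
    (fun _ _ _ => by ext; simp [mulh, Finset.sum_add_distrib])
    (fun _ _ _ => by ext; simp [mulh, Finset.smul_sum])

/-- The `ħ`-bracket of `𝒱[ħ]` as a bilinear map. -/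
def brₗ : (ℕ → V) →ₗ[ℂ] (ℕ → V) →ₗ[ℂ] (ℕ → V) :=
  LinearMap.mk₂ ℂ (hbrh 𝒱 H')
    (fun _ _ _ => by ext; simp [hbrh, Finset.sum_add_distrib])
    (fun _ _ _ => by ext; simp [hbrh, Finset.smul_sum])
    (fun _ _ _ => by ext; simp [hbrh, Finset.sum_add_distrib])
    (fun _ _ _ => by ext; simp [hbrh, Finset.smul_sum])

lemma mulₗ_hmon (m k : ℕ) (u v : V) :
    mulₗ 𝒱 (hmon m u) (hmon k v) = hmon (m + k) (𝒱.mul u v) := by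
  ext r
  simp only [mulₗ, LinearMap.mk₂_apply, mulh, hmon_apply]
  split_ifs with h
  · rw [Finset.sum_eq_single m]
    · simp [h]
    · intro i _ hi
      simp [hi]
    · intro hm
      exact absurd (Finset.mem_range.2 (by omega)) hm
  · refine Finset.sum_eq_zero fun i hi => ?_
    have := Finset.mem_range.1 hi
    split_ifs <;> first | omega | simp

variable {H'}

lemma brₗ_hmon_left (m : ℕ) (u : V) (g : ℕ → V) (r : ℕ) :
    brₗ 𝒱 H' (hmon m u) g r
      = if m ≤ r then ∑ l ∈ Finset.range (r + 1 - m),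
          𝒱.br l (binomOp (H' - 1) l u) (g (r - m - l)) else 0 := by
  simp only [brₗ, LinearMap.mk₂_apply, hbrh, hmon_apply]
  split_ifs with h
  · rw [Finset.sum_eq_single m]
    · simp
    · intro i _ hi
      simp [hi]
    · intro hm
      exact absurd (Finset.mem_range.2 (by omega)) hm
  · refine Finset.sum_eq_zero fun i hi => Finset.sum_eq_zero fun l _ => ?_
    have := Finset.mem_range.1 hi
    rw [if_neg (by omega)]
    simp

lemma brₗ_hmon (m k : ℕ) (u v : V) (r : ℕ) :
    brₗ 𝒱 H' (hmon m u) (hmon k v) r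
      = if m + k ≤ r then 𝒱.br (r - m - k) (binomOp (H' - 1) (r - m - k) u) v else 0 := by
  rw [brₗ_hmon_left]
  by_cases h : m + k ≤ r
  · rw [if_pos (by omega), if_pos h, Finset.sum_eq_single (r - m - k)]
    · rw [hmon_apply, if_pos (by omega)]
    · intro l hl hne
      have := Finset.mem_range.1 hl
      rw [hmon_apply, if_neg (by omega), map_zero]
    · intro hm
      exact absurd (Finset.mem_range.2 (by omega)) hm
  · rw [if_neg h, ite_eq_right_iff]
    intro _
    refine Finset.sum_eq_zero fun l hl => ?_
    have := Finset.mem_range.1 hl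
    rw [hmon_apply, if_neg (by omega), map_zero]

lemma succ_mul_choose (x : ℂ) (l : ℕ) :
    ((l : ℂ) + 1) * Ring.choose x (l + 1) = (x - l) * Ring.choose x l := by
  have := Ring.choose_smul_choose x (Nat.le_succ l)
  simpa [mul_comm] using this

lemma binomOp_apply_eigen {u : V} {g : ℂ} (hu : H' u = g • u) (l : ℕ) :
    binomOp (H' - 1) l u = Ring.choose (g - 1) l • u := by
  induction l with
  | zero => simp [binomOp]
  | succ l ih =>
    have h1 : ((l : ℂ) + 1) ≠ 0 := Nat.cast_add_one_ne_zero l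
    have h2 : Ring.choose (g - 1) (l + 1)
        = ((l : ℂ) + 1)⁻¹ * ((g - 1 - l) * Ring.choose (g - 1) l) := by
      rw [← succ_mul_choose, inv_mul_cancel_left₀ h1]
    simp only [binomOp, LinearMap.smul_apply, Module.End.mul_apply, ih, map_smul,
      LinearMap.sub_apply, Module.End.one_apply, hu, h2]
    module

lemma brₗ_hmon_eigen {u v : V} {g : ℂ} (hu : H' u = g • u) (m k : ℕ) {N : ℕ}
    (hN : ∀ l, N ≤ l → 𝒱.br l u v = 0) :
    brₗ 𝒱 H' (hmon m u) (hmon k v)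
      = ∑ l ∈ Finset.range N, Ring.choose (g - 1) l • hmon (m + k + l) (𝒱.br l u v) := by
  ext r
  rw [brₗ_hmon, Finset.sum_apply, binomOp_apply_eigen hu, map_smul, LinearMap.smul_apply]
  simp only [Pi.smul_apply, hmon_apply]
  by_cases h : m + k ≤ r
  · rw [if_pos h]
    by_cases h2 : r - m - k < N
    · rw [Finset.sum_eq_single (r - m - k), if_pos (by omega)]
      · intro l _ hl
        rw [if_neg (by omega), smul_zero]
      · intro hm
        exact absurd (Finset.mem_range.2 h2) hm
    · rw [hN _ (by omega), smul_zero]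
      refine (Finset.sum_eq_zero fun l hl => ?_).symm
      have := Finset.mem_range.1 hl
      rw [if_neg (by omega), smul_zero]
  · rw [if_neg h]
    refine (Finset.sum_eq_zero fun l hl => ?_).symm
    rw [if_neg (by omega), smul_zero]

end Polynomials

section Ideal

/-- The element `ħ^m (T + ħH')a · b` for `a` of index `i`. -/
def genT (i : Idx) (m : ℕ) (a b : V) : ℕ → V :=
  hmon m (𝒱.mul (𝒱.T a) b) + ((gamI i : ℝ) : ℂ) • hmon (m + 1) (𝒱.mul a b)

/-- The submodule `J_{ħ,Γ}` described in terms of a grading. -/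
def zhuIdeal (A : Idx → Submodule ℂ V) : Submodule ℂ (ℕ → V) :=
  Submodule.span ℂ
    ({x | ∃ (m : ℕ) (i j : Idx) (a b : V), a ∈ A i ∧ b ∈ A j ∧ i.2.1 = 0 ∧ j.2.1 = 0 ∧
      x = genT 𝒱 i m a b} ∪
    {x | ∃ (m : ℕ) (i j : Idx) (a b : V), a ∈ A i ∧ b ∈ A j ∧ i.2.1 + j.2.1 = 0 ∧ i.2.1 ≠ 0 ∧
      x = hmon m (𝒱.mul a b)})

variable {𝒱}

lemma genT_mem {A : Idx → Submodule ℂ V} (m : ℕ) {i j : Idx} {a b : V} (ha : a ∈ A i)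
    (hb : b ∈ A j) (hi : i.2.1 = 0) (hj : j.2.1 = 0) : genT 𝒱 i m a b ∈ zhuIdeal 𝒱 A :=
  Submodule.subset_span (Or.inl ⟨m, i, j, a, b, ha, hb, hi, hj, rfl⟩)

lemma hmon_mul_mem {A : Idx → Submodule ℂ V} (m : ℕ) {i j : Idx} {a b : V} (ha : a ∈ A i)
    (hb : b ∈ A j) (hij : i.2.1 + j.2.1 = 0) (hi : i.2.1 ≠ 0) :
    hmon m (𝒱.mul a b) ∈ zhuIdeal 𝒱 A :=
  Submodule.subset_span (Or.inr ⟨m, i, j, a, b, ha, hb, hij, hi, rfl⟩)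

lemma zhuIdeal_le {A : Idx → Submodule ℂ V} {S : Submodule ℂ (ℕ → V)}
    (h₀ : ∀ (m : ℕ) (i j : Idx), i.2.1 = 0 → j.2.1 = 0 → ∀ a ∈ A i, ∀ b ∈ A j,
      genT 𝒱 i m a b ∈ S)
    (h₁ : ∀ (m : ℕ) (i j : Idx), i.2.1 + j.2.1 = 0 → i.2.1 ≠ 0 → ∀ a ∈ A i, ∀ b ∈ A j,
      hmon m (𝒱.mul a b) ∈ S) : zhuIdeal 𝒱 A ≤ S := by
  refine Submodule.span_le.2 ?_
  rintro x (⟨m, i, j, a, b, ha, hb, hi, hj, rfl⟩ | ⟨m, i, j, a, b, ha, hb, hij, hi, rfl⟩)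
  · exact h₀ m i j hi hj a ha b hb
  · exact h₁ m i j hij hi a ha b hb

lemma coe_epsC (q : AddCircle (1 : ℝ)) : ((epsC q : ℝ) : AddCircle (1 : ℝ)) = -q := by
  rw [epsC, AddCircle.coe_neg]
  exact congrArg _ AddCircle.coe_equivIco

lemma epsC_nonpos (q : AddCircle (1 : ℝ)) : epsC q ≤ 0 := by
  have := (AddCircle.equivIco 1 0 q).2.1
  rw [epsC]
  linarith

lemma neg_one_lt_epsC (q : AddCircle (1 : ℝ)) : -1 < epsC q := by
  have := (AddCircle.equivIco 1 0 q).2.2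
  rw [epsC]
  linarith

lemma epsC_eq_zero {q : AddCircle (1 : ℝ)} : epsC q = 0 ↔ q = 0 :=
  ⟨fun h => epsC_injective (h.trans epsC_zero.symm), fun h => h ▸ epsC_zero⟩

lemma add_eq_zero_of_epsC {q r : AddCircle (1 : ℝ)} {k : ℤ} (h : epsC q + epsC r = k) :
    q + r = 0 := by
  have h' : ((epsC q + epsC r : ℝ) : AddCircle (1 : ℝ)) = 0 :=
    (AddCircle.coe_eq_zero_iff 1).2 ⟨k, by simp [h]⟩
  rw [AddCircle.coe_add, coe_epsC, coe_epsC, ← neg_add, neg_eq_zero] at h'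
  exact h'

lemma epsC_add_eq_neg_one {q r : AddCircle (1 : ℝ)} (h : q + r = 0) (hq : q ≠ 0) :
    epsC q + epsC r = -1 := by
  have h' : ((epsC q + epsC r : ℝ) : AddCircle (1 : ℝ)) = 0 := by
    rw [AddCircle.coe_add, coe_epsC, coe_epsC, ← neg_add, h, neg_zero]
  obtain ⟨k, hk⟩ := (AddCircle.coe_eq_zero_iff 1).1 h'
  have h1 : epsC q < 0 := lt_of_le_of_ne (epsC_nonpos q) (mt epsC_eq_zero.1 hq)
  have h2 := epsC_nonpos r
  have h3 := neg_one_lt_epsC q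
  have h4 := neg_one_lt_epsC r
  simp only [zsmul_eq_mul, mul_one] at hk
  have h5 : k < 0 := by
    rify
    linarith
  have h6 : -2 < k := by
    rify
    linarith
  obtain rfl : k = -1 := by omega
  rw [← hk]
  simp

lemma genJ_of_chiz {e₁ e₂ : ℝ} (h : chiz e₁ e₂ = 1) (a b : V) :
    genJ 𝒱 H' e₁ e₂ a b = hmon 0 (𝒱.mul a b) := by
  rw [genJ, if_pos h, ofV_eq_hmon]

lemma genJ_of_chiz_ne {e₁ e₂ : ℝ} (h : chiz e₁ e₂ ≠ 1) (a b : V) :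
    genJ 𝒱 H' e₁ e₂ a b = hmon 0 (𝒱.mul (𝒱.T a) b) + hmon 1 (𝒱.mul (H' a) b) := by
  rw [genJ, if_neg h]
  ext k
  simp only [Pi.add_apply, hmon_apply]
  split_ifs <;> simp_all

lemma genJ_add_left (e₁ e₂ : ℝ) (a a' b : V) :
    genJ 𝒱 H' e₁ e₂ (a + a') b = genJ 𝒱 H' e₁ e₂ a b + genJ 𝒱 H' e₁ e₂ a' b := by
  by_cases h : chiz e₁ e₂ = 1
  · simp [genJ_of_chiz H' h]
  · simp only [genJ_of_chiz_ne H' h, map_add, LinearMap.add_apply]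
    abel

lemma genJ_add_right (e₁ e₂ : ℝ) (a b b' : V) :
    genJ 𝒱 H' e₁ e₂ a (b + b') = genJ 𝒱 H' e₁ e₂ a b + genJ 𝒱 H' e₁ e₂ a b' := by
  by_cases h : chiz e₁ e₂ = 1
  · simp [genJ_of_chiz H' h]
  · simp only [genJ_of_chiz_ne H' h, map_add]
    abel

variable (𝒱)

lemma zhuIdeal_le_JΓ (hH' : ∀ Δ γ : ℝ, ∀ a ∈ G Δ γ, H' a = ((gam Δ γ : ℝ) : ℂ) • a) :
    zhuIdeal 𝒱 (homog 𝒱 G) ≤ JΓ 𝒱 H' G := by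
  refine zhuIdeal_le (fun m i j hi hj a ha b hb => ?_) (fun m i j hij hi a ha b hb => ?_)
  · refine Submodule.subset_span
      ⟨m, i.1, gamI i, j.1, gamI j, a, b, 0, ha.1, hb.1, ?_, ?_⟩
    · simp [eps_gamI, hi, hj, epsC_zero]
    · rw [eps_gamI, eps_gamI, hi, hj, genJ_of_chiz_ne H' (by norm_num [chiz, epsC_zero]),
        hshift_iterate_add, hshift_iterate_hmon, hshift_iterate_hmon,
        homog_eigen 𝒱 H' G hH' ha]
      simp [genT]
  · refine Submodule.subset_span
      ⟨m, i.1, gamI i, j.1, gamI j, a, b, -1, ha.1, hb.1, ?_, ?_⟩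
    · simp [eps_gamI, epsC_add_eq_neg_one hij hi]
    · rw [eps_gamI, eps_gamI, genJ_of_chiz H' (by simp [chiz, epsC_add_eq_neg_one hij hi]),
        hshift_iterate_hmon, add_zero]

lemma JΓ_le_zhuIdeal (hper : ∀ Δ γ : ℝ, G Δ (γ + 1) = G Δ γ)
    (hH' : ∀ Δ γ : ℝ, ∀ a ∈ G Δ γ, H' a = ((gam Δ γ : ℝ) : ℂ) • a)
    (hpar : ∀ Δ γ : ℝ, ∀ a ∈ G Δ γ, 𝒱.par a ∈ G Δ γ) :
    JΓ 𝒱 H' G ≤ zhuIdeal 𝒱 (homog 𝒱 G) := by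
  refine Submodule.span_le.2 ?_
  rintro x ⟨m, Δ₁, γ₁, Δ₂, γ₂, a, b, k, ha, hb, hk, rfl⟩
  refine parity_induction 𝒱 (P := fun a => hshift^[m] (genJ 𝒱 H' _ _ a b) ∈ _) _ (hpar Δ₁ γ₁)
    (fun p a ha hap => ?_) (fun a a' h h' => ?_) ha
  swap
  · rw [genJ_add_left, hshift_iterate_add]
    exact add_mem h h'
  refine parity_induction 𝒱 (P := fun b => hshift^[m] (genJ 𝒱 H' _ _ a b) ∈ _) _ (hpar Δ₂ γ₂)
    (fun q b hb hbq => ?_) (fun b b' h h' => ?_) hb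
  swap
  · rw [genJ_add_right, hshift_iterate_add]
    exact add_mem h h'
  have ha' := mem_homog 𝒱 G hper ha hap
  have hb' := mem_homog 𝒱 G hper hb hbq
  have e (Δ γ : ℝ) : eps Δ γ = epsC ((Δ - γ : ℝ) : AddCircle (1 : ℝ)) := (epsC_coe _).symm
  rw [e, e] at hk ⊢
  have hsum := add_eq_zero_of_epsC hk
  by_cases h : ((Δ₁ - γ₁ : ℝ) : AddCircle (1 : ℝ)) = 0
  · have h' : ((Δ₂ - γ₂ : ℝ) : AddCircle (1 : ℝ)) = 0 := by rwa [h, zero_add] at hsum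
    rw [genJ_of_chiz_ne H' (by norm_num [chiz, h, h', epsC_zero]), hshift_iterate_add,
      hshift_iterate_hmon, hshift_iterate_hmon, homog_eigen 𝒱 H' G hH' ha']
    simpa [genT] using genT_mem (𝒱 := 𝒱) m ha' hb' h h'
  · rw [genJ_of_chiz H' (if_pos (epsC_add_eq_neg_one hsum h).le), hshift_iterate_hmon]
    exact hmon_mul_mem (m + 0) ha' hb' hsum h

lemma VΓh_le (hper : ∀ Δ γ : ℝ, G Δ (γ + 1) = G Δ γ)
    (hpar : ∀ Δ γ : ℝ, ∀ a ∈ G Δ γ, 𝒱.par a ∈ G Δ γ) {S : Submodule ℂ (ℕ → V)}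
    (hS : ∀ (k : ℕ) (i : Idx), i.2.1 = 0 → ∀ a ∈ homog 𝒱 G i, hmon k a ∈ S) : VΓh G ≤ S := by
  refine Submodule.span_le.2 ?_
  rintro x ⟨m, Δ, γ, a, ha, he, rfl⟩
  rw [ofV_eq_hmon, hshift_iterate_hmon]
  refine parity_induction 𝒱 (P := fun a => hmon (m + 0) a ∈ S) _ (hpar Δ γ)
    (fun p a ha hap => ?_) (fun a b h h' => ?_) ha
  · refine hS _ _ ?_ a (mem_homog 𝒱 G hper ha hap)
    rw [← epsC_eq_zero, epsC_coe]
    exact he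
  · rw [map_add]
    exact add_mem h h'

end Ideal

section Brackets

variable {𝒱 H'} {A : Idx → Submodule ℂ V} {D : Module.End ℂ V}

lemma IsGradedDer.sub_der (hD : IsGradedDer 𝒱 A D) (a b : V) :
    (𝒱.T - D) (𝒱.mul a b) = 𝒱.mul ((𝒱.T - D) a) b + 𝒱.mul a ((𝒱.T - D) b) := by
  simp only [LinearMap.sub_apply, 𝒱.T_der, hD.der, map_sub]
  abel

lemma IsGradedDer.br_right (hD : IsGradedDer 𝒱 A D) (n : ℕ) (a b : V) :
    𝒱.br n a (D b) = 𝒱.br n a (𝒱.T b) := by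
  have := hD.central n a b
  rw [LinearMap.sub_apply, map_sub, sub_eq_zero] at this
  exact this.symm

lemma IsGradedDer.br_left (hD : IsGradedDer 𝒱 A D) (n : ℕ) (a b : V) :
    𝒱.br n (D a) b = 𝒱.br n (𝒱.T a) b := by
  have := (central_iff _).1 (fun n c => hD.central n c a) n b
  rw [LinearMap.sub_apply, map_sub, LinearMap.sub_apply, sub_eq_zero] at this
  exact this.symm

lemma br_T (l : ℕ) (c a : V) :
    𝒱.br l c (𝒱.T a) = 𝒱.T (𝒱.br l c a) + (l : ℂ) • 𝒱.br (l - 1) c a := by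
  cases l with
  | zero => simp [𝒱.sesqT, 𝒱.sesq₀]
  | succ l =>
    rw [𝒱.sesqT, 𝒱.sesq, add_tsub_cancel_right]
    push_cast
    module

lemma IsGrading.iterate_T_br_mem (hA : IsGrading 𝒱 H' A) (hD : IsGradedDer 𝒱 A D) (r n : ℕ)
    {i j : Idx} {a b : V} (ha : a ∈ A i) (hb : b ∈ A j) :
    (𝒱.T ^ r) (𝒱.br n a b) ∈ A (i + j - wt (n + 1) + wt r) := by
  induction r generalizing i j a b with
  | zero => simpa [wt_zero] using hA.br_mem n ha hb
  | succ r ih =>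
    rw [pow_succ, Module.End.mul_apply, 𝒱.sesqT, ← hD.br_left, ← hD.br_right, map_add, wt_succ r]
    refine add_mem ?_ ?_
    · have := ih (hD.mem ha) hb
      rwa [show i + wt 1 + j - wt (n + 1) + wt r = i + j - wt (n + 1) + (wt r + wt 1) by abel]
        at this
    · have := ih ha (hD.mem hb)
      rwa [show i + (j + wt 1) - wt (n + 1) + wt r = i + j - wt (n + 1) + (wt r + wt 1) by abel]
        at this

lemma IsGrading.br_T_mul (hA : IsGrading 𝒱 H' A) (hD : IsGradedDer 𝒱 A D) {p : ZMod 2} {c : V}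
    (hc : 𝒱.par c = ((-1 : ℂ) ^ p.val) • c) {i : Idx} {a : V} (ha : a ∈ A i) (l : ℕ) (b : V) :
    𝒱.br l c (𝒱.mul (𝒱.T a) b)
      = 𝒱.mul (𝒱.br l c (𝒱.T a)) b + psgn p i.2.2 • 𝒱.mul (𝒱.T a) (𝒱.br l c b) := by
  have h1 := par_mul_br_eq_zero hD.sub_der hD.central p l a b c
  have h2 := mul_br_eq_zero hD.sub_der hD.central l a b c
  have h3 : twist 𝒱 p (D a) = psgn p i.2.2 • D a := by
    have := twist_apply (p := p) (hA.par_eq (hD.mem ha))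
    simpa [wt] using this
  rw [LinearMap.sub_apply, map_sub, map_sub, LinearMap.sub_apply, sub_eq_zero] at h1
  rw [LinearMap.sub_apply, map_sub, LinearMap.sub_apply, sub_eq_zero] at h2
  rw [br_mul hc, h1, h3, h2, map_smul, LinearMap.smul_apply]

lemma IsGrading.brₗ_genT_mem (hA : IsGrading 𝒱 H' A) (hD : IsGradedDer 𝒱 A D) {h i j : Idx}
    {c a b : V} (hc : c ∈ A h) (ha : a ∈ A i) (hb : b ∈ A j) (hh : h.2.1 = 0) (hi : i.2.1 = 0)
    (hj : j.2.1 = 0) (k m : ℕ) :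
    brₗ 𝒱 H' (hmon k c) (genT 𝒱 i m a b) ∈ zhuIdeal 𝒱 A := by
  obtain ⟨N₁, h₁⟩ := 𝒱.trunc c (𝒱.mul (𝒱.T a) b)
  obtain ⟨N₂, h₂⟩ := 𝒱.trunc c (𝒱.mul a b)
  obtain ⟨N₃, h₃⟩ := 𝒱.trunc c a
  obtain ⟨N, hN₁, hN₂, hN₃⟩ : ∃ N, N₁ ≤ N ∧ N₂ ≤ N ∧ N₃ ≤ N - 1 :=
    ⟨N₁ + N₂ + N₃ + 1, by omega, by omega, by omega⟩
  rw [genT, map_add, map_smul, brₗ_hmon_eigen 𝒱 (hA.eigen hc) _ _ fun l hl => h₁ l (hN₁.trans hl),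
    brₗ_hmon_eigen 𝒱 (hA.eigen hc) _ _ fun l hl => h₂ l (hN₂.trans hl), Finset.smul_sum,
    ← Finset.sum_add_distrib]
  let f (l : ℕ) : ℕ → V := ((l : ℂ) * Ring.choose ((gamI h : ℂ) - 1) l) •
    hmon (k + m + l) (𝒱.mul (𝒱.br (l - 1) c a) b)
  have hf : ∑ l ∈ Finset.range N, (f (l + 1) - f l) = 0 := by
    rw [Finset.sum_range_sub]
    simp [f, h₃ _ hN₃]
  rw [← add_zero (Finset.sum _ _), ← hf, ← Finset.sum_add_distrib]
  refine Submodule.sum_mem _ fun l _ => ?_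
  have key : Ring.choose ((gamI h : ℂ) - 1) l • (psgn h.2.2 i.2.2 •
        genT 𝒱 i (k + m + l) a (𝒱.br l c b)
      + genT 𝒱 (h + i - wt (l + 1)) (k + m + l) (𝒱.br l c a) b) ∈ zhuIdeal 𝒱 A := by
    refine Submodule.smul_mem _ _ (add_mem (Submodule.smul_mem _ _ ?_) ?_)
    · exact genT_mem _ ha (hA.br_mem l hc hb) hi (by simp [wt, hh, hj])
    · exact genT_mem _ (hA.br_mem l hc ha) hb (by simp [wt, hh, hi]) hj
  convert key using 1
  have hC := succ_mul_choose ((gamI h : ℂ) - 1) l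
  simp only [f, genT, hA.br_T_mul hD (hA.par_eq hc) ha, br_T, br_mul (hA.par_eq hc),
    twist_apply (hA.par_eq ha), gamI_sub_wt, gamI_add hh, map_add, map_smul, LinearMap.add_apply,
    LinearMap.smul_apply, Nat.add_sub_cancel]
  rw [show k + (m + 1) + l = k + m + l + 1 by ring, show k + m + (l + 1) = k + m + l + 1 by ring]
  push_cast
  rw [hC]
  module

lemma IsGrading.brₗ_hmon_mul_mem (hA : IsGrading 𝒱 H' A) {h i j : Idx} {c a b : V}
    (hc : c ∈ A h) (ha : a ∈ A i) (hb : b ∈ A j) (hh : h.2.1 = 0) (hij : i.2.1 + j.2.1 = 0)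
    (hi : i.2.1 ≠ 0) (k m : ℕ) :
    brₗ 𝒱 H' (hmon k c) (hmon m (𝒱.mul a b)) ∈ zhuIdeal 𝒱 A := by
  obtain ⟨N, hN⟩ := 𝒱.trunc c (𝒱.mul a b)
  rw [brₗ_hmon_eigen 𝒱 (hA.eigen hc) _ _ hN]
  refine Submodule.sum_mem _ fun l _ => Submodule.smul_mem _ _ ?_
  rw [br_mul (hA.par_eq hc), twist_apply (hA.par_eq ha), map_add, map_smul, LinearMap.smul_apply,
    map_smul]
  refine add_mem ?_ (Submodule.smul_mem _ _ ?_)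
  · exact hmon_mul_mem _ (hA.br_mem l hc ha) hb (by simp [wt, hh, hij]) (by simp [wt, hh, hi])
  · exact hmon_mul_mem _ ha (hA.br_mem l hc hb) (by simp [wt, hh, hij]) hi

end Brackets

section Products

variable {𝒱 H'} {A : Idx → Submodule ℂ V}

lemma IsGrading.mulₗ_hmon_mem (hA : IsGrading 𝒱 H' A) {h : Idx} {c : V} (hc : c ∈ A h)
    (hh : h.2.1 = 0) (k : ℕ) {f : ℕ → V} (hf : f ∈ zhuIdeal 𝒱 A) :
    mulₗ 𝒱 f (hmon k c) ∈ zhuIdeal 𝒱 A := by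
  suffices zhuIdeal 𝒱 A ≤ (zhuIdeal 𝒱 A).comap ((mulₗ 𝒱).flip (hmon k c)) from this hf
  refine zhuIdeal_le (fun m i j hi hj a ha b hb => ?_) (fun m i j hij hi a ha b hb => ?_)
  · have := genT_mem (𝒱 := 𝒱) (m + k) ha (hA.mul_mem hb hc) hi (by simp [hj, hh])
    simpa [genT, mulₗ_hmon, 𝒱.mul_assoc', add_right_comm m 1 k] using this
  · have := hmon_mul_mem (𝒱 := 𝒱) (m + k) ha (hA.mul_mem hb hc) (by simpa [hh] using hij) hi
    simpa [mulₗ_hmon, 𝒱.mul_assoc'] using this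

lemma IsGrading.hmon_mulₗ_mem (hA : IsGrading 𝒱 H' A) {h : Idx} {c : V} (hc : c ∈ A h)
    (hh : h.2.1 = 0) (k : ℕ) {f : ℕ → V} (hf : f ∈ zhuIdeal 𝒱 A) :
    mulₗ 𝒱 (hmon k c) f ∈ zhuIdeal 𝒱 A := by
  suffices zhuIdeal 𝒱 A ≤ (zhuIdeal 𝒱 A).comap (mulₗ 𝒱 (hmon k c)) from this hf
  refine zhuIdeal_le (fun m i j hi hj a ha b hb => ?_) (fun m i j hij hi a ha b hb => ?_)
  · have := sub_mem (genT_mem (𝒱 := 𝒱) (k + m) (hA.mul_mem hc ha) hb (by simp [hi, hh]) hj)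
      (genT_mem (𝒱 := 𝒱) (k + m) hc (hA.mul_mem ha hb) hh (by simp [hi, hj]))
    rw [Submodule.mem_comap]
    convert this using 1
    simp only [genT, mulₗ_hmon, 𝒱.T_der, gamI_add hh, map_add, map_smul, LinearMap.add_apply,
      𝒱.mul_assoc', add_assoc k m 1]
    push_cast
    module
  · have := hmon_mul_mem (𝒱 := 𝒱) (k + m) (hA.mul_mem hc ha) hb (by simpa [hh] using hij)
      (by simpa [hh] using hi)
    simpa [mulₗ_hmon, 𝒱.mul_assoc'] using this

end Products

section Skew

variable {𝒱 H'} {A : Idx → Submodule ℂ V} {D : Module.End ℂ V}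

lemma IsGrading.mul_vac (hA : IsGrading 𝒱 H' A) (x : V) : 𝒱.mul x 𝒱.vac = x := by
  refine hA.induction (fun i a ha => ?_) (fun a b ha hb => by simp [ha, hb]) x
  rw [𝒱.mul_comm' i.2.2 0 a 𝒱.vac (hA.par_eq ha) (by simp [𝒱.vac_even]), 𝒱.one_mul']
  simp [psgn]

lemma br_swap {p q : ZMod 2} {a b : V} (ha : 𝒱.par a = ((-1 : ℂ) ^ p.val) • a)
    (hb : 𝒱.par b = ((-1 : ℂ) ^ q.val) • b) {N : ℕ} (hN : ∀ l, N ≤ l → 𝒱.br l a b = 0) (n : ℕ) :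
    𝒱.br n b a = -psgn p q • ∑ r ∈ Finset.range (N - n),
      ((-1 : ℂ) ^ (n + r) * ((Nat.factorial r : ℂ))⁻¹) • (𝒱.T ^ r) (𝒱.br (n + r) a b) := by
  rw [𝒱.skew p q a b ha hb n, finsum_eq_sum_of_support_subset]
  intro r hr
  by_contra h
  rw [Finset.coe_range, Set.mem_Iio, not_lt] at h
  exact hr (by simp [hN (n + r) (by omega)])

/-- Modulo `J_{ħ,Γ}`, the operator `T` acts on brackets as `-ħH'`. -/
lemma IsGrading.mkQ_iterate_T_br (hA : IsGrading 𝒱 H' A) (hD : IsGradedDer 𝒱 A D) (m n : ℕ)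
    {i j : Idx} {a b : V} (ha : a ∈ A i) (hb : b ∈ A j) (hi : i.2.1 = 0) (hj : j.2.1 = 0) (r : ℕ) :
    (zhuIdeal 𝒱 A).mkQ (hmon m ((𝒱.T ^ r) (𝒱.br n a b)))
      = ((r.factorial : ℂ) * Ring.choose (-((gamI i : ℂ) + gamI j - n - 1)) r) •
          (zhuIdeal 𝒱 A).mkQ (hmon (m + r) (𝒱.br n a b)) := by
  induction r generalizing m with
  | zero => simp
  | succ r ih =>
    have hmem := genT_mem (𝒱 := 𝒱) m (hA.iterate_T_br_mem hD r n ha hb) hA.vac_mem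
      (by simp [wt, hi, hj]) (by simp)
    rw [← Submodule.Quotient.mk_eq_zero, ← Submodule.mkQ_apply, genT, hA.mul_vac, hA.mul_vac,
      map_add, map_smul, ih, ← Module.End.mul_apply, ← pow_succ', add_eq_zero_iff_eq_neg] at hmem
    have hC := succ_mul_choose (-((gamI i : ℂ) + gamI j - n - 1)) r
    rw [hmem, smul_smul, ← neg_smul, add_right_comm m 1 r, add_assoc m r 1]
    congr 1
    rw [Nat.factorial_succ, gamI_add_wt, gamI_sub_wt, gamI_add hi]
    push_cast
    linear_combination -(r.factorial : ℂ) * hC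

lemma sum_choose_mul_choose (x y : ℂ) (l : ℕ) :
    ∑ n ∈ Finset.range (l + 1), Ring.choose (y - 1) n * Ring.choose (-(x + y - l - 1)) (l - n)
      = (-1) ^ l * Ring.choose (x - 1) l := by
  have h := Ring.add_choose_eq l (Commute.all (y - 1) (-(x + y - l - 1)))
  rw [Finset.Nat.sum_antidiagonal_eq_sum_range_succ
    fun i j => Ring.choose (y - 1) i * Ring.choose (-(x + y - l - 1)) j] at h
  rw [← h, show y - 1 + -(x + y - l - 1) = -(x - l) by ring, Ring.choose_neg,
    sub_add_cancel]
  simp [Int.negOnePow_def, Units.smul_def]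

lemma IsGrading.skew_mem (hA : IsGrading 𝒱 H' A) (hD : IsGradedDer 𝒱 A D) {i j : Idx} {a b : V}
    (ha : a ∈ A i) (hb : b ∈ A j) (hi : i.2.1 = 0) (hj : j.2.1 = 0) (m k : ℕ) :
    brₗ 𝒱 H' (hmon m b) (hmon k a) + psgn i.2.2 j.2.2 • brₗ 𝒱 H' (hmon k a) (hmon m b)
      ∈ zhuIdeal 𝒱 A := by
  obtain ⟨N, hN⟩ := 𝒱.trunc a b
  have hswap := br_swap (hA.par_eq ha) (hA.par_eq hb) hN
  have hN' : ∀ l, N ≤ l → 𝒱.br l b a = 0 := fun l hl => by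
    rw [hswap, Nat.sub_eq_zero_of_le hl]
    simp
  rw [← Submodule.Quotient.mk_eq_zero, ← Submodule.mkQ_apply, map_add, map_smul,
    brₗ_hmon_eigen 𝒱 (hA.eigen ha) _ _ hN, brₗ_hmon_eigen 𝒱 (hA.eigen hb) _ _ hN']
  let Y (l : ℕ) := (zhuIdeal 𝒱 A).mkQ (hmon (k + m + l) (𝒱.br l a b))
  have h₁ (n : ℕ) : (zhuIdeal 𝒱 A).mkQ (hmon (m + k + n) (𝒱.br n b a))
      = -psgn i.2.2 j.2.2 • ∑ r ∈ Finset.range (N - n), ((-1 : ℂ) ^ (n + r) *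
        Ring.choose (-((gamI i : ℂ) + gamI j - (n + r : ℕ) - 1)) r) • Y (n + r) := by
    rw [hswap]
    simp only [map_smul, map_sum, hA.mkQ_iterate_T_br hD _ _ ha hb hi hj, smul_smul, Y]
    congr 1
    refine Finset.sum_congr rfl fun r _ => ?_
    rw [show m + k + n + r = k + m + (n + r) by ring]
    congr 1
    rw [mul_assoc, inv_mul_cancel_left₀ (Nat.cast_ne_zero.2 (Nat.factorial_ne_zero r))]
  have h₂ : ∑ n ∈ Finset.range N, Ring.choose ((gamI j : ℂ) - 1) n •
      ∑ r ∈ Finset.range (N - n), ((-1 : ℂ) ^ (n + r) *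
        Ring.choose (-((gamI i : ℂ) + gamI j - (n + r : ℕ) - 1)) r) • Y (n + r)
      = ∑ l ∈ Finset.range N, Ring.choose ((gamI i : ℂ) - 1) l • Y l := by
    simp only [Finset.smul_sum]
    rw [← Finset.sum_range_diag_flip N fun n r => Ring.choose ((gamI j : ℂ) - 1) n •
      ((-1 : ℂ) ^ (n + r) * Ring.choose (-((gamI i : ℂ) + gamI j - (n + r : ℕ) - 1)) r) •
        Y (n + r)]
    refine Finset.sum_congr rfl fun l _ => ?_
    have h := sum_choose_mul_choose (gamI i) (gamI j) l
    have h' : Ring.choose ((gamI i : ℂ) - 1) l = (-1) ^ l *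
        ∑ n ∈ Finset.range (l + 1), Ring.choose ((gamI j : ℂ) - 1) n *
          Ring.choose (-((gamI i : ℂ) + gamI j - l - 1)) (l - n) := by
      rw [h, ← mul_assoc, ← mul_pow]
      simp
    rw [h', Finset.mul_sum, Finset.sum_smul]
    refine Finset.sum_congr rfl fun n hn => ?_
    rw [Nat.add_sub_cancel' (Nat.lt_succ_iff.1 (Finset.mem_range.1 hn)), smul_smul]
    congr 1
    ring
  simp only [map_sum, map_smul, h₁]
  rw [← h₂]
  simp only [smul_comm _ (-psgn i.2.2 j.2.2), ← Finset.smul_sum]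
  rw [← add_smul, neg_add_cancel, zero_smul]

end Skew

section LieIdeal

variable {𝒱 H'} {A : Idx → Submodule ℂ V} {D : Module.End ℂ V}

lemma IsGrading.br_eigenOp_eq_zero (hA : IsGrading 𝒱 H' A) {z : V}
    (hz : ∀ n b, 𝒱.br n z b = 0) (n : ℕ) (b : V) : 𝒱.br n (H' z) b = 0 := by
  obtain ⟨π, hπ⟩ := hA.exists_isProj
  refine hA.induction (fun j b hb => ?_) (fun b b' h h' => by simp [h, h']) b
  refine hπ.eq_zero hA fun m => ?_
  have h₁ (x : V) := hπ.map_shift hA (F := (𝒱.br n).flip b) (s := j - wt (n + 1))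
    (fun i a ha => add_sub_assoc i j _ ▸ hA.br_mem n ha hb) (m - (j - wt (n + 1))) x
  have h₂ := hπ.map_shift hA (F := H') (s := 0)
    (fun i a ha => by rw [add_zero, hA.eigen ha]; exact Submodule.smul_mem _ _ ha)
    (m - (j - wt (n + 1))) z
  simp only [sub_add_cancel, LinearMap.flip_apply, add_zero] at h₁ h₂
  rw [h₁, h₂, hA.eigen (hπ.mem _ _), map_smul, LinearMap.smul_apply, ← h₁, hz, map_zero,
    smul_zero]

lemma IsGrading.br_binomOp_eq_zero (hA : IsGrading 𝒱 H' A) {z : V}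
    (hz : ∀ n b, 𝒱.br n z b = 0) (l n : ℕ) (b : V) :
    𝒱.br n (binomOp (H' - 1) l z) b = 0 := by
  induction l generalizing n b with
  | zero => simpa [binomOp] using hz n b
  | succ l ih => simp [binomOp, hA.br_eigenOp_eq_zero ih, ih]

lemma IsGrading.brₗ_comm_mem (hA : IsGrading 𝒱 H' A) (hD : IsGradedDer 𝒱 A D) {h j : Idx}
    {c x : V} (hc : c ∈ A h) (hx : x ∈ A j) (hh : h.2.1 = 0) (hj : j.2.1 = 0) {m k : ℕ}
    (hcx : brₗ 𝒱 H' (hmon k c) (hmon m x) ∈ zhuIdeal 𝒱 A) :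
    brₗ 𝒱 H' (hmon m x) (hmon k c) ∈ zhuIdeal 𝒱 A :=
  (Submodule.add_mem_iff_left _ (Submodule.smul_mem _ _ hcx)).1
    (hA.skew_mem hD hc hx hh hj m k)

lemma IsGrading.hmon_brₗ_mem (hA : IsGrading 𝒱 H' A) {h : Idx} {c : V} (hc : c ∈ A h)
    (hh : h.2.1 = 0) (k : ℕ) {f : ℕ → V} (hf : f ∈ zhuIdeal 𝒱 A) :
    brₗ 𝒱 H' (hmon k c) f ∈ zhuIdeal 𝒱 A := by
  obtain ⟨D, hD⟩ := hA.exists_isGradedDer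
  suffices zhuIdeal 𝒱 A ≤ (zhuIdeal 𝒱 A).comap (brₗ 𝒱 H' (hmon k c)) from this hf
  exact zhuIdeal_le
    (fun m i j hi hj a ha b hb => hA.brₗ_genT_mem hD hc ha hb hh hi hj k m)
    (fun m i j hij hi a ha b hb => hA.brₗ_hmon_mul_mem hc ha hb hh hij hi k m)

lemma IsGrading.brₗ_hmon_mem (hA : IsGrading 𝒱 H' A) {h : Idx} {c : V} (hc : c ∈ A h)
    (hh : h.2.1 = 0) (k : ℕ) {f : ℕ → V} (hf : f ∈ zhuIdeal 𝒱 A) :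
    brₗ 𝒱 H' f (hmon k c) ∈ zhuIdeal 𝒱 A := by
  obtain ⟨D, hD⟩ := hA.exists_isGradedDer
  suffices zhuIdeal 𝒱 A ≤ (zhuIdeal 𝒱 A).comap ((brₗ 𝒱 H').flip (hmon k c)) from this hf
  refine zhuIdeal_le (fun m i j hi hj a ha b hb => ?_) (fun m i j hij hi a ha b hb => ?_)
  · rw [Submodule.mem_comap, LinearMap.flip_apply]
    have hz := br_mul_der_eq_zero (𝒱 := 𝒱) hD.sub_der hD.central
    have hzl : brₗ 𝒱 H' (hmon m (𝒱.mul ((𝒱.T - D) a) b)) (hmon k c) = 0 := by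
      ext r
      rw [brₗ_hmon, hA.br_binomOp_eq_zero ((central_iff _).1 fun n c => hz n a b c)]
      simp
    have hzr : brₗ 𝒱 H' (hmon k c) (hmon m (𝒱.mul ((𝒱.T - D) a) b)) = 0 := by
      ext r
      rw [brₗ_hmon, hz]
      simp
    have hmem := hA.brₗ_genT_mem hD hc ha hb hh hi hj k m
    rw [LinearMap.sub_apply, map_sub, LinearMap.sub_apply, map_sub, map_sub, sub_eq_zero] at hzr
    rw [LinearMap.sub_apply, map_sub, LinearMap.sub_apply, map_sub, map_sub,
      LinearMap.sub_apply, sub_eq_zero] at hzl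
    rw [genT, map_add, map_smul, hzr] at hmem
    rw [genT, map_add, map_smul, LinearMap.add_apply, LinearMap.smul_apply, hzl]
    have h₁ := hA.skew_mem hD hc (hA.mul_mem (hD.mem ha) hb) hh (by simp [wt, hi, hj]) m k
    have h₂ := hA.skew_mem hD hc (hA.mul_mem ha hb) hh (by simp [hi, hj]) (m + 1) k
    have hp : (i + wt 1 + j).2.2 = (i + j).2.2 := by simp [wt]
    rw [hp] at h₁
    refine (Submodule.add_mem_iff_left _
      (Submodule.smul_mem _ (psgn h.2.2 (i + j).2.2) hmem)).1 ?_
    convert add_mem h₁ (Submodule.smul_mem _ ((gamI i : ℝ) : ℂ) h₂) using 1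
    module
  · exact hA.brₗ_comm_mem hD hc (hA.mul_mem ha hb) hh (by simpa using hij)
      (hA.brₗ_hmon_mul_mem hc ha hb hh hij hi k m)

end LieIdeal

section PoissonIdentities

variable {𝒱 H'} {A : Idx → Submodule ℂ V}

lemma mulh_assoc (f g h : ℕ → V) : mulh 𝒱 (mulh 𝒱 f g) h = mulh 𝒱 f (mulh 𝒱 g h) := by
  ext k
  simp only [mulh, map_sum, LinearMap.sum_apply, 𝒱.mul_assoc']
  have := Finset.sum_range_diag_flip (k + 1)
    fun j l => 𝒱.mul (f j) (𝒱.mul (g l) (h (k - (j + l))))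
  refine Eq.trans ?_ (this.trans ?_)
  · refine Finset.sum_congr rfl fun i _ => Finset.sum_congr rfl fun j hj => ?_
    rw [Nat.add_sub_cancel' (Nat.lt_succ_iff.1 (Finset.mem_range.1 hj))]
  · refine Finset.sum_congr rfl fun j hj => ?_
    rw [Nat.sub_add_comm (Nat.lt_succ_iff.1 (Finset.mem_range.1 hj))]
    simp only [Nat.sub_sub]

lemma mulₗ_hmon_zero_right (f : ℕ → V) (c : V) (k : ℕ) :
    mulₗ 𝒱 f (hmon 0 c) k = 𝒱.mul (f k) c := by
  simp only [mulₗ, LinearMap.mk₂_apply, mulh, hmon_apply]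
  rw [Finset.sum_range_succ, Finset.sum_eq_zero]
  · simp
  · intro i hi
    have := Finset.mem_range.1 hi
    rw [if_neg (by omega), map_zero]

lemma mulₗ_hmon_zero_left (f : ℕ → V) (b : V) (k : ℕ) :
    mulₗ 𝒱 (hmon 0 b) f k = 𝒱.mul b (f k) := by
  simp only [mulₗ, LinearMap.mk₂_apply, mulh, hmon_apply]
  rw [Finset.sum_range_succ', Finset.sum_eq_zero]
  · simp
  · intro i _
    rw [if_neg (by omega), map_zero, LinearMap.zero_apply]

lemma brₗ_hmon_zero (u v : V) (r : ℕ) :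
    brₗ 𝒱 H' (hmon 0 u) (hmon 0 v) r = 𝒱.br r (binomOp (H' - 1) r u) v := by
  simp [brₗ_hmon]

lemma brₗ_hmon_zero_right (f : ℕ → V) (c : V) (r : ℕ) :
    brₗ 𝒱 H' f (hmon 0 c) r
      = ∑ i ∈ Finset.range (r + 1), 𝒱.br (r - i) (binomOp (H' - 1) (r - i) (f i)) c := by
  simp only [brₗ, LinearMap.mk₂_apply, hbrh, hmon_apply]
  refine Finset.sum_congr rfl fun i hi => ?_
  have := Finset.mem_range.1 hi
  rw [Finset.sum_eq_single (r - i)]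
  · simp
  · intro l hl hne
    have := Finset.mem_range.1 hl
    rw [if_neg (by omega), map_zero]
  · intro hm
    exact absurd (Finset.mem_range.2 (by omega)) hm

lemma IsGrading.par_binomOp (hA : IsGrading 𝒱 H' A) {c : ℂ} {a : V} (ha : 𝒱.par a = c • a)
    (l : ℕ) : 𝒱.par (binomOp (H' - 1) l a) = c • binomOp (H' - 1) l a := by
  have hcomm := commute_of_eigen hA.span (fun _ _ => hA.par_eq) (fun _ _ => hA.eigen)
  have h (x : V) : 𝒱.par (H' x) = H' (𝒱.par x) := congrArg (fun f => f x) hcomm.eq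
  induction l with
  | zero => simpa [binomOp] using ha
  | succ l ih =>
    simp only [binomOp, LinearMap.smul_apply, Module.End.mul_apply, LinearMap.sub_apply,
      Module.End.one_apply, map_smul, map_sub, h, ih]
    module

lemma IsGrading.brₗ_mulₗ (hA : IsGrading 𝒱 H' A) {p q : ZMod 2} {a b : V}
    (ha : 𝒱.par a = ((-1 : ℂ) ^ p.val) • a) (hb : 𝒱.par b = ((-1 : ℂ) ^ q.val) • b) (c : V) :
    brₗ 𝒱 H' (hmon 0 a) (mulₗ 𝒱 (hmon 0 b) (hmon 0 c))
      = mulₗ 𝒱 (brₗ 𝒱 H' (hmon 0 a) (hmon 0 b)) (hmon 0 c)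
        + psgn p q • mulₗ 𝒱 (hmon 0 b) (brₗ 𝒱 H' (hmon 0 a) (hmon 0 c)) := by
  ext r
  rw [mulₗ_hmon, zero_add, Pi.add_apply, Pi.smul_apply, mulₗ_hmon_zero_right,
    mulₗ_hmon_zero_left, brₗ_hmon_zero, brₗ_hmon_zero, brₗ_hmon_zero,
    𝒱.leibniz p q _ b (hA.par_binomOp ha r) hb]

lemma sum_choose_mul_choose_mul_choose (x y : ℂ) (j n : ℕ) :
    ∑ s ∈ Finset.range (n + 1),
        Ring.choose x (j + s) * Ring.choose y (n - s) * ((j + s).choose j : ℂ)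
      = Ring.choose x j * Ring.choose (x - j + y) n := by
  rw [Ring.add_choose_eq n (Commute.all _ _), Finset.Nat.sum_antidiagonal_eq_sum_range_succ
    fun i k => Ring.choose (x - j) i * Ring.choose y k, Finset.mul_sum]
  refine Finset.sum_congr rfl fun s _ => ?_
  have := Ring.choose_smul_choose x (Nat.le_add_right j s)
  rw [Nat.add_sub_cancel_left, nsmul_eq_mul] at this
  rw [← mul_assoc, ← this]
  ring

lemma IsGrading.brₗ_jacobi (hA : IsGrading 𝒱 H' A) {i j : Idx} {a b : V} (ha : a ∈ A i)
    (hb : b ∈ A j) (hi : i.2.1 = 0) (c : V) :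
    brₗ 𝒱 H' (hmon 0 a) (brₗ 𝒱 H' (hmon 0 b) (hmon 0 c))
        - psgn i.2.2 j.2.2 • brₗ 𝒱 H' (hmon 0 b) (brₗ 𝒱 H' (hmon 0 a) (hmon 0 c))
      = brₗ 𝒱 H' (brₗ 𝒱 H' (hmon 0 a) (hmon 0 b)) (hmon 0 c) := by
  ext r
  rw [Pi.sub_apply, Pi.smul_apply, brₗ_hmon_left, brₗ_hmon_left, brₗ_hmon_zero_right]
  simp only [zero_le, if_true, tsub_zero, brₗ_hmon_zero, binomOp_apply_eigen (hA.eigen ha), binomOp_apply_eigen (hA.eigen hb),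
    map_smul, LinearMap.smul_apply, binomOp_apply_eigen (hA.eigen (hA.br_mem _ ha hb))]
  rw [← Finset.sum_flip fun l => Ring.choose ((gamI i : ℂ) - 1) (r - l) •
      Ring.choose ((gamI j : ℂ) - 1) l • 𝒱.br l b (𝒱.br (r - l) a c),
    Finset.smul_sum, ← Finset.sum_sub_distrib]
  let F (k s : ℕ) : V := (Ring.choose ((gamI i : ℂ) - 1) (k + s) *
    Ring.choose ((gamI j : ℂ) - 1) (r - k - s) * ((k + s).choose k : ℂ)) •
      𝒱.br (r - k) (𝒱.br k a b) c
  refine Eq.trans ?_ ((Finset.sum_range_diag_flip (r + 1) F).trans ?_)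
  · refine Finset.sum_congr rfl fun l hl => ?_
    have hl' := Nat.lt_succ_iff.1 (Finset.mem_range.1 hl)
    have h := 𝒱.jacobi i.2.2 j.2.2 a b c (hA.par_eq ha) (hA.par_eq hb) l (r - l)
    rw [Nat.sub_sub_self hl', Nat.add_sub_cancel' hl'] at *
    have h' : ∑ k ∈ Finset.range (l + 1), F k (l - k)
        = (Ring.choose ((gamI i : ℂ) - 1) l * Ring.choose ((gamI j : ℂ) - 1) (r - l)) •
          ∑ k ∈ Finset.range (l + 1), (l.choose k : ℂ) • 𝒱.br (r - k) (𝒱.br k a b) c := by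
      rw [Finset.smul_sum]
      refine Finset.sum_congr rfl fun k hk => ?_
      have hk' := Nat.lt_succ_iff.1 (Finset.mem_range.1 hk)
      simp only [F]
      rw [Nat.add_sub_cancel' hk', show r - k - (l - k) = r - l by omega, smul_smul]
    rw [h', ← h]
    module
  · refine Finset.sum_congr rfl fun k hk => ?_
    have hk' := Nat.lt_succ_iff.1 (Finset.mem_range.1 hk)
    rw [Nat.sub_add_comm hk', ← Finset.sum_smul, sum_choose_mul_choose_mul_choose, smul_smul,
      gamI_sub_wt, gamI_add hi]
    congr 3
    push_cast
    ring

end PoissonIdentities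

/-- `J_{ħ,Γ}` is a two-sided ideal of `𝒱_{ħ,Γ}` for both the
commutative product and the ħ-bracket, and `Zhu_{ħ,Γ} 𝒱 = 𝒱_{ħ,Γ}/J_{ħ,Γ}` is a
Poisson superalgebra over `ℂ[ħ]`; moreover the Jacobi identity for `{·,·}_ħ` holds
already in `𝒱_{ħ,Γ}`. -/
theorem statement_18
    -- Γ/ℤ-graded Poisson vertex algebra with Hamiltonian operator H (real eigenvalues)
    (Γ : AddSubgroup ℝ) (hΓ : ∀ n : ℤ, (n : ℝ) ∈ Γ)
    (H : Module.End ℂ V)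
    (hper : ∀ Δ γ : ℝ, G Δ (γ + 1) = G Δ γ)
    (hsupp : ∀ Δ γ : ℝ, γ ∉ Γ → G Δ γ = ⊥)
    (hspan : (⨆ (Δ : ℝ) (γ : ℝ), G Δ γ) = ⊤)
    (heig : ∀ Δ γ : ℝ, ∀ a ∈ G Δ γ, H a = ((Δ : ℝ) : ℂ) • a)
    (hH' : ∀ Δ γ : ℝ, ∀ a ∈ G Δ γ, H' a = ((gam Δ γ : ℝ) : ℂ) • a)
    (hvac : 𝒱.vac ∈ G 0 0)
    (hpar : ∀ Δ γ : ℝ, ∀ a ∈ G Δ γ, 𝒱.par a ∈ G Δ γ)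
    (hmulmem : ∀ (Δ₁ γ₁ Δ₂ γ₂ : ℝ) (a b : V), a ∈ G Δ₁ γ₁ → b ∈ G Δ₂ γ₂ →
      𝒱.mul a b ∈ G (Δ₁ + Δ₂) (γ₁ + γ₂))
    (hbrmem : ∀ (n : ℕ) (Δ₁ γ₁ Δ₂ γ₂ : ℝ) (a b : V), a ∈ G Δ₁ γ₁ → b ∈ G Δ₂ γ₂ →
      𝒱.br n a b ∈ G (Δ₁ + Δ₂ - n - 1) (γ₁ + γ₂)) :
    -- J_{ħ,Γ} is a two-sided ideal for both operations
    (∀ f ∈ JΓ 𝒱 H' G, ∀ g ∈ VΓh G,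
        mulh 𝒱 f g ∈ JΓ 𝒱 H' G ∧ mulh 𝒱 g f ∈ JΓ 𝒱 H' G ∧
        hbrh 𝒱 H' f g ∈ JΓ 𝒱 H' G ∧ hbrh 𝒱 H' g f ∈ JΓ 𝒱 H' G) ∧
    -- the quotient is a Poisson superalgebra over ℂ[ħ]:
    -- supercommutativity and associativity of the product (exactly),
    (∀ (pa pb : ZMod 2) (a b : V),
      𝒱.par a = ((-1 : ℂ) ^ pa.val) • a → 𝒱.par b = ((-1 : ℂ) ^ pb.val) • b →
      mulh 𝒱 (ofV a) (ofV b) = psgn pa pb • mulh 𝒱 (ofV b) (ofV a)) ∧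
    (∀ f g h : ℕ → V, mulh 𝒱 (mulh 𝒱 f g) h = mulh 𝒱 f (mulh 𝒱 g h)) ∧
    -- skewsymmetry of the ħ-bracket modulo J_{ħ,Γ},
    (∀ (pa pb : ZMod 2) (Δ₁ γ₁ Δ₂ γ₂ : ℝ) (a b : V),
      𝒱.par a = ((-1 : ℂ) ^ pa.val) • a → 𝒱.par b = ((-1 : ℂ) ^ pb.val) • b →
      a ∈ G Δ₁ γ₁ → b ∈ G Δ₂ γ₂ → eps Δ₁ γ₁ = 0 → eps Δ₂ γ₂ = 0 →
      hbrh 𝒱 H' (ofV b) (ofV a) + psgn pa pb • hbrh 𝒱 H' (ofV a) (ofV b)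
        ∈ JΓ 𝒱 H' G) ∧
    -- the Leibniz rule (exactly),
    (∀ (pa pb : ZMod 2) (a b : V),
      𝒱.par a = ((-1 : ℂ) ^ pa.val) • a → 𝒱.par b = ((-1 : ℂ) ^ pb.val) • b →
      ∀ c : V,
      hbrh 𝒱 H' (ofV a) (mulh 𝒱 (ofV b) (ofV c))
        = mulh 𝒱 (hbrh 𝒱 H' (ofV a) (ofV b)) (ofV c)
          + psgn pa pb • mulh 𝒱 (ofV b) (hbrh 𝒱 H' (ofV a) (ofV c))) ∧
    -- and the Jacobi identity, which holds already in 𝒱_{ħ,Γ} (exactly):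
    (∀ (pa pb : ZMod 2) (Δ₁ γ₁ Δ₂ γ₂ Δ₃ γ₃ : ℝ) (a b c : V),
      𝒱.par a = ((-1 : ℂ) ^ pa.val) • a → 𝒱.par b = ((-1 : ℂ) ^ pb.val) • b →
      a ∈ G Δ₁ γ₁ → b ∈ G Δ₂ γ₂ → c ∈ G Δ₃ γ₃ →
      eps Δ₁ γ₁ = 0 → eps Δ₂ γ₂ = 0 → eps Δ₃ γ₃ = 0 →
      hbrh 𝒱 H' (ofV a) (hbrh 𝒱 H' (ofV b) (ofV c))
          - psgn pa pb • hbrh 𝒱 H' (ofV b) (hbrh 𝒱 H' (ofV a) (ofV c))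
        = hbrh 𝒱 H' (hbrh 𝒱 H' (ofV a) (ofV b)) (ofV c)) := by
  have hA : IsGrading 𝒱 H' (homog 𝒱 G) :=
    isGrading_homog 𝒱 H' G H hper hspan heig hH' hvac hpar hmulmem hbrmem
  have hJ : JΓ 𝒱 H' G = zhuIdeal 𝒱 (homog 𝒱 G) :=
    le_antisymm (JΓ_le_zhuIdeal 𝒱 H' G hper hH' hpar) (zhuIdeal_le_JΓ 𝒱 H' G hH')
  obtain ⟨D, hD⟩ := hA.exists_isGradedDer
  simp only [ofV_eq_hmon, hJ]
  have hclass {Δ γ : ℝ} (h : eps Δ γ = 0) : ((Δ - γ : ℝ) : AddCircle (1 : ℝ)) = 0 := by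
    rw [← epsC_eq_zero, epsC_coe]
    exact h
  refine ⟨fun f hf g hg => ⟨?_, ?_, ?_, ?_⟩, fun pa pb a b ha hb => ?_, mulh_assoc,
    fun pa pb Δ₁ γ₁ Δ₂ γ₂ a b hap hbp ha hb hea heb => ?_, fun pa pb a b ha hb c => ?_,
    fun pa pb Δ₁ γ₁ Δ₂ γ₂ Δ₃ γ₃ a b c hap hbp ha hb _ hea _ _ => ?_⟩
  · exact VΓh_le 𝒱 G hper hpar (S := (zhuIdeal 𝒱 (homog 𝒱 G)).comap (mulₗ 𝒱 f))
      (fun k i hi c hc => hA.mulₗ_hmon_mem hc hi k hf) hg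
  · exact VΓh_le 𝒱 G hper hpar (S := (zhuIdeal 𝒱 (homog 𝒱 G)).comap ((mulₗ 𝒱).flip f))
      (fun k i hi c hc => hA.hmon_mulₗ_mem hc hi k hf) hg
  · exact VΓh_le 𝒱 G hper hpar (S := (zhuIdeal 𝒱 (homog 𝒱 G)).comap (brₗ 𝒱 H' f))
      (fun k i hi c hc => hA.brₗ_hmon_mem hc hi k hf) hg
  · exact VΓh_le 𝒱 G hper hpar (S := (zhuIdeal 𝒱 (homog 𝒱 G)).comap ((brₗ 𝒱 H').flip f))
      (fun k i hi c hc => hA.hmon_brₗ_mem hc hi k hf) hg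
  · have h (x y : V) : mulh 𝒱 (hmon 0 x) (hmon 0 y) = hmon 0 (𝒱.mul x y) := mulₗ_hmon 𝒱 0 0 x y
    rw [h, h, 𝒱.mul_comm' pa pb a b ha hb, map_smul]
  · exact hA.skew_mem hD (mem_homog 𝒱 G hper ha hap) (mem_homog 𝒱 G hper hb hbp)
      (hclass hea) (hclass heb) 0 0
  · exact hA.brₗ_mulₗ ha hb c
  · exact hA.brₗ_jacobi (mem_homog 𝒱 G hper ha hap) (mem_homog 𝒱 G hper hb hbp) (hclass hea) c

end Stmt18
end
end
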